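/- Fix σ_λ, σ_μ > 0 and let X_n, Y_n be independent random Hermitian matrices such that X_n/√(σ_λ² n) and Y_n/√(σ_μ² n) are n×n GUE matrices. For 1 ≤ j ≤ k ≤ n let λ_{j,k} denote the j-th largest eigenvalue of the top-left k×k principal minor of X_n, and μ_{j,k} the j-th largest eigenvalue of the top-left k×k principal minor of Y_n. Then there exist constants C' > 0 and A > 0 (depending only on σ_λ, σ_μ) such that for all n ≥ 2, with probability at least 1 − n^{−100}, ∑_{k=1}^{n} ( |μ_{1,k} − E[μ_{1,k}]| + |λ_{k,k} − E[λ_{k,k}]| ) ≤ C' n^{4/3} (log n)^{A}. -/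

import Mathlib

open MeasureTheory ProbabilityTheory

noncomputable section

instance matrixMeasurableSpace {n : ℕ} : MeasurableSpace (Matrix (Fin n) (Fin n) ℂ) :=
  (inferInstance : MeasurableSpace (Fin n → Fin n → ℂ))

/-- The distribution of an `n×n` GUE matrix. -/
def gueMeasure (n : ℕ) : Measure (Matrix (Fin n) (Fin n) ℂ) :=
  Measure.map
    (fun ω : (Fin n → ℝ) × (Fin n × Fin n → ℝ × ℝ) =>
      Matrix.of fun i j =>
        if i = j then (ω.1 i : ℂ)
        else if i < j then ((ω.2 (i, j)).1 : ℂ) + ((ω.2 (i, j)).2 : ℂ) * Complex.I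
        else ((ω.2 (j, i)).1 : ℂ) - ((ω.2 (j, i)).2 : ℂ) * Complex.I)
    ((Measure.pi fun _ : Fin n => gaussianReal 0 1).prod
      (Measure.pi fun _ : Fin n × Fin n =>
        (gaussianReal 0 (1 / 2)).prod (gaussianReal 0 (1 / 2))))

/-- The eigenvalues of a (Hermitian) matrix, in nonincreasing order. -/
def eigsDesc {n : ℕ} (M : Matrix (Fin n) (Fin n) ℂ) : Fin n → ℝ :=
  if h : M.IsHermitian then fun i => h.eigenvalues (Tuple.sort h.eigenvalues i.rev) else 0

/-- `λ_{i,j}(X_n)` for `X_n = √(σ² n) · M`: the `j`-th largest eigenvalue of the top-left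
`i × i` principal minor of `X_n` (for `1 ≤ j ≤ i ≤ n`; junk value `0` otherwise). -/
def minorEig {n : ℕ} (σ : ℝ) (M : Matrix (Fin n) (Fin n) ℂ) (i j : ℕ) : ℝ :=
  if h : 1 ≤ j ∧ j ≤ i ∧ i ≤ n then
    Real.sqrt (σ ^ 2 * n) *
      eigsDesc (Matrix.of fun a b : Fin i =>
        M ⟨a.val, by omega⟩ ⟨b.val, by omega⟩) ⟨j - 1, by omega⟩
  else 0

section

open Complex Matrix

lemma sum_eq_diag_add_sum_lt {n : ℕ} {R : Type*} [AddCommMonoid R] (F : Fin n → Fin n → R) :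
    ∑ i, ∑ j, F i j = ∑ i, F i i +
      ∑ p : Fin n × Fin n, if p.1 < p.2 then F p.1 p.2 + F p.2 p.1 else 0 := by
  have h1 : ∀ i, F i i = ∑ j, if i = j then F i j else 0 := by intro i; simp
  have h2 : ∑ p : Fin n × Fin n, (if p.1 < p.2 then F p.1 p.2 + F p.2 p.1 else 0)
      = ∑ i, ∑ j, (if i < j then F i j else 0) + ∑ i, ∑ j, (if j < i then F i j else 0) := by
    rw [Fintype.sum_prod_type, Finset.sum_comm (f := fun i j => if j < i then F i j else 0),
      ← Finset.sum_add_distrib]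
    refine Finset.sum_congr rfl fun i _ => ?_
    rw [← Finset.sum_add_distrib]
    refine Finset.sum_congr rfl fun j _ => ?_
    split_ifs <;> simp
  rw [h2, Finset.sum_congr rfl fun i _ => h1 i, ← Finset.sum_add_distrib,
    ← Finset.sum_add_distrib]
  refine Finset.sum_congr rfl fun i _ => ?_
  rw [← Finset.sum_add_distrib, ← Finset.sum_add_distrib]
  refine Finset.sum_congr rfl fun j _ => ?_
  rcases lt_trichotomy i j with h | h | h
  · simp [h, h.ne, h.not_gt]
  · simp [h]
  · simp [h, h.ne', h.not_gt]

/-- The squared Frobenius norm of the Hermitian part of `A`. -/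
def hermNormSq {n : ℕ} (A : Matrix (Fin n) (Fin n) ℂ) : ℝ :=
  ((A * Aᴴ).trace.re + (A * A).trace.re) / 2

lemma hermNormSq_eq_sum {n : ℕ} (A : Matrix (Fin n) (Fin n) ℂ) :
    hermNormSq A = ∑ i, ∑ j, (((A i j).re ^ 2 + (A i j).im ^ 2) +
      ((A i j).re * (A j i).re - (A i j).im * (A j i).im)) / 2 := by
  simp only [hermNormSq, trace, diag, mul_apply, conjTranspose_apply, re_sum]
  rw [← Finset.sum_add_distrib, Finset.sum_div]
  refine Finset.sum_congr rfl fun i _ => ?_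
  rw [← Finset.sum_add_distrib, Finset.sum_div]
  refine Finset.sum_congr rfl fun j _ => ?_
  simp [Complex.mul_re]
  ring

lemma integral_cexp_gaussianReal (v : NNReal) (t : ℝ) :
    ∫ x, cexp ((t * x : ℝ) * I) ∂(gaussianReal 0 v) = cexp (-(v * t ^ 2 / 2 : ℝ)) := by
  have := charFun_gaussianReal (μ := 0) (v := v) t
  rw [charFun_apply_real] at this
  push_cast at this ⊢
  rw [this]
  congr 1
  simp

lemma measurable_matrix_iff {n : ℕ} {α : Type*} [MeasurableSpace α]
    {f : α → Matrix (Fin n) (Fin n) ℂ} (hf : ∀ i j, Measurable fun a => f a i j) :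
    Measurable f :=
  measurable_pi_lambda _ fun i => measurable_pi_lambda _ fun j => hf i j

lemma measurable_entry {n : ℕ} (i j : Fin n) :
    Measurable fun M : Matrix (Fin n) (Fin n) ℂ => M i j :=
  (measurable_pi_apply j).comp (measurable_pi_apply (X := fun _ : Fin n => Fin n → ℂ) i)

/-- The parametrization of Hermitian matrices by their independent real coordinates. -/
def gueParam (n : ℕ) (ω : (Fin n → ℝ) × (Fin n × Fin n → ℝ × ℝ)) : Matrix (Fin n) (Fin n) ℂ :=
  Matrix.of fun i j =>
    if i = j then (ω.1 i : ℂ)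
    else if i < j then ((ω.2 (i, j)).1 : ℂ) + ((ω.2 (i, j)).2 : ℂ) * Complex.I
    else ((ω.2 (j, i)).1 : ℂ) - ((ω.2 (j, i)).2 : ℂ) * Complex.I

lemma measurable_gueParam (n : ℕ) : Measurable (gueParam n) := by
  refine measurable_matrix_iff fun i j => ?_
  simp only [gueParam, of_apply]
  split_ifs <;> fun_prop

/-- The law of the independent real coordinates of a GUE matrix. -/
def gueCoord (n : ℕ) : Measure ((Fin n → ℝ) × (Fin n × Fin n → ℝ × ℝ)) :=
  (Measure.pi fun _ : Fin n => gaussianReal 0 1).prod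
    (Measure.pi fun _ : Fin n × Fin n =>
      (gaussianReal 0 (1 / 2)).prod (gaussianReal 0 (1 / 2)))

instance (n : ℕ) : IsProbabilityMeasure (gueCoord n) := by unfold gueCoord; infer_instance

lemma gueMeasure_eq (n : ℕ) : gueMeasure n = (gueCoord n).map (gueParam n) := rfl

instance isProbabilityMeasure_gueMeasure (n : ℕ) : IsProbabilityMeasure (gueMeasure n) := by
  rw [gueMeasure_eq]
  exact Measure.isProbabilityMeasure_map (measurable_gueParam n).aemeasurable

lemma measurable_re_trace_mul {n : ℕ} (A : Matrix (Fin n) (Fin n) ℂ) :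
    Measurable fun M : Matrix (Fin n) (Fin n) ℂ => (A * M).trace.re := by
  simp only [trace, diag, mul_apply]
  refine Complex.measurable_re.comp (Finset.measurable_fun_sum _ fun i _ =>
    Finset.measurable_fun_sum _ fun j _ => ?_)
  exact measurable_const.mul (measurable_entry j i)

lemma measurable_cexp_re_trace_mul {n : ℕ} (A : Matrix (Fin n) (Fin n) ℂ) :
    Measurable fun M : Matrix (Fin n) (Fin n) ℂ => cexp (((A * M).trace.re : ℝ) * I) := by
  have := measurable_re_trace_mul A
  fun_prop

/-- The characteristic functional of the GUE. -/
theorem integral_cexp_re_trace_gueMeasure {n : ℕ} (A : Matrix (Fin n) (Fin n) ℂ) :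
    ∫ M, cexp (((A * M).trace.re : ℝ) * I) ∂(gueMeasure n)
      = cexp (-(hermNormSq A / 2 : ℝ)) := by
  rw [gueMeasure_eq, integral_map (measurable_gueParam n).aemeasurable
    (measurable_cexp_re_trace_mul A).aestronglyMeasurable]
  have key : ∀ ω : (Fin n → ℝ) × (Fin n × Fin n → ℝ × ℝ),
      (A * gueParam n ω).trace.re = ∑ i, (A i i).re * ω.1 i +
        ∑ p : Fin n × Fin n, ((if p.1 < p.2 then (A p.1 p.2).re + (A p.2 p.1).re else 0)
            * (ω.2 p).1 +
          (if p.1 < p.2 then (A p.1 p.2).im - (A p.2 p.1).im else 0) * (ω.2 p).2) := by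
    intro ω
    simp only [trace, diag, mul_apply, re_sum]
    rw [sum_eq_diag_add_sum_lt]
    congr 1
    · refine Finset.sum_congr rfl fun i _ => ?_
      simp [gueParam]
    · refine Finset.sum_congr rfl fun p _ => ?_
      by_cases h : p.1 < p.2
      · simp [gueParam, h, h.ne, h.ne', h.not_gt]
        ring
      · simp [h]
  have h2 : ∀ ω : (Fin n → ℝ) × (Fin n × Fin n → ℝ × ℝ),
      cexp (((A * gueParam n ω).trace.re : ℝ) * I) =
      (∏ i, cexp (((A i i).re * ω.1 i : ℝ) * I)) *
      ∏ p : Fin n × Fin n,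
        (cexp (((if p.1 < p.2 then (A p.1 p.2).re + (A p.2 p.1).re else 0) * (ω.2 p).1 : ℝ) * I) *
        cexp (((if p.1 < p.2 then (A p.1 p.2).im - (A p.2 p.1).im else 0) * (ω.2 p).2 : ℝ) * I)) := by
    intro ω
    rw [key ω, Complex.ofReal_add, add_mul, Complex.exp_add, Complex.ofReal_sum, Finset.sum_mul,
      Complex.exp_sum, Complex.ofReal_sum, Finset.sum_mul, Complex.exp_sum]
    congr 1
    refine Finset.prod_congr rfl fun p _ => ?_
    rw [← Complex.exp_add, Complex.ofReal_add, add_mul]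
  simp_rw [h2]
  rw [gueCoord, integral_prod_mul
    (f := fun x : Fin n → ℝ => ∏ i, cexp (((A i i).re * x i : ℝ) * I))
    (g := fun y : Fin n × Fin n → ℝ × ℝ => ∏ p : Fin n × Fin n,
        (cexp (((if p.1 < p.2 then (A p.1 p.2).re + (A p.2 p.1).re else 0) * (y p).1 : ℝ) * I) *
        cexp (((if p.1 < p.2 then (A p.1 p.2).im - (A p.2 p.1).im else 0) * (y p).2 : ℝ) * I))),
    integral_fintype_prod_eq_prod (f := fun i (x : ℝ) => cexp (((A i i).re * x : ℝ) * I)),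
    integral_fintype_prod_eq_prod (f := fun (p : Fin n × Fin n) (y : ℝ × ℝ) =>
        (cexp (((if p.1 < p.2 then (A p.1 p.2).re + (A p.2 p.1).re else 0) * y.1 : ℝ) * I) *
        cexp (((if p.1 < p.2 then (A p.1 p.2).im - (A p.2 p.1).im else 0) * y.2 : ℝ) * I)))]
  have h3 : ∀ p : Fin n × Fin n, ∫ y : ℝ × ℝ,
        (cexp (((if p.1 < p.2 then (A p.1 p.2).re + (A p.2 p.1).re else 0) * y.1 : ℝ) * I) *
        cexp (((if p.1 < p.2 then (A p.1 p.2).im - (A p.2 p.1).im else 0) * y.2 : ℝ) * I))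
        ∂((gaussianReal 0 (1 / 2)).prod (gaussianReal 0 (1 / 2))) =
      cexp (-((if p.1 < p.2 then (((A p.1 p.2).re + (A p.2 p.1).re) ^ 2 +
        ((A p.1 p.2).im - (A p.2 p.1).im) ^ 2) / 4 else 0 : ℝ) : ℂ)) := by
    intro p
    rw [integral_prod_mul (f := fun x : ℝ =>
        cexp (((if p.1 < p.2 then (A p.1 p.2).re + (A p.2 p.1).re else 0) * x : ℝ) * I))
      (g := fun x : ℝ =>
        cexp (((if p.1 < p.2 then (A p.1 p.2).im - (A p.2 p.1).im else 0) * x : ℝ) * I)),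
      integral_cexp_gaussianReal, integral_cexp_gaussianReal, ← Complex.exp_add]
    congr 1
    split_ifs
    · push_cast; ring
    · simp
  rw [Finset.prod_congr rfl fun p _ => h3 p,
    Finset.prod_congr rfl fun i _ => integral_cexp_gaussianReal 1 _,
    ← Complex.exp_sum, ← Complex.exp_sum, ← Complex.exp_add]
  congr 1
  rw [Finset.sum_neg_distrib, Finset.sum_neg_distrib, ← neg_add, ← Complex.ofReal_sum,
    ← Complex.ofReal_sum, ← Complex.ofReal_add]
  congr 2
  rw [hermNormSq_eq_sum, sum_eq_diag_add_sum_lt, add_div, Finset.sum_div, Finset.sum_div]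
  congr 1
  · refine Finset.sum_congr rfl fun i _ => ?_
    push_cast; ring
  · refine Finset.sum_congr rfl fun p _ => ?_
    split_ifs <;> ring

/-- A finite measure with the characteristic functional of the GUE is the GUE. -/
theorem eq_gueMeasure_of_integral_cexp {n : ℕ} (μ : Measure (Matrix (Fin n) (Fin n) ℂ))
    [IsFiniteMeasure μ]
    (h : ∀ A : Matrix (Fin n) (Fin n) ℂ, ∫ M, cexp (((A * M).trace.re : ℝ) * I) ∂μ
      = cexp (-(hermNormSq A / 2 : ℝ))) : μ = gueMeasure n := by
  let μ' : Measure (Fin n → Fin n → ℂ) := μ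
  let ν' : Measure (Fin n → Fin n → ℂ) := gueMeasure n
  have : IsFiniteMeasure μ' := ‹IsFiniteMeasure μ›
  have : IsFiniteMeasure ν' := (inferInstance : IsFiniteMeasure (gueMeasure n))
  suffices hs : μ' = ν' from hs
  refine Measure.ext_of_charFunDual ?_
  ext L
  set A : Matrix (Fin n) (Fin n) ℂ := Matrix.of fun i j =>
    (L (Pi.single j (Pi.single i 1)) : ℂ) - (L (Pi.single j (Pi.single i I)) : ℂ) * I with hA
  have hL : ∀ M : Fin n → Fin n → ℂ, L M = (A * (Matrix.of M)).trace.re := by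
    intro M
    have hM : M = ∑ j, ∑ i, ((M j i).re • (Pi.single j (Pi.single i (1 : ℂ)) : Fin n → Fin n → ℂ)
        + (M j i).im • (Pi.single j (Pi.single i I) : Fin n → Fin n → ℂ)) := by
      ext a b
      have hs : ∀ (j i : Fin n) (c : ℂ),
          (Pi.single j (Pi.single i c) : Fin n → Fin n → ℂ) a b =
            if a = j then (if b = i then c else 0) else 0 := by
        intro j i c
        by_cases h1 : a = j
        · subst h1
          simp [Pi.single_apply]
        · simp [h1]
      simp only [Finset.sum_apply, Pi.add_apply, Pi.smul_apply, hs]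
      rw [Finset.sum_eq_single a, Finset.sum_eq_single b]
      · simp [Complex.re_add_im]
      · intro i _ hi
        simp [hi.symm]
      · simp
      · intro j _ hj
        simp [hj.symm]
      · simp
    conv_lhs => rw [hM]
    simp only [map_sum, map_add, map_smul, trace, diag, mul_apply, re_sum]
    rw [Finset.sum_comm]
    refine Finset.sum_congr rfl fun i _ => Finset.sum_congr rfl fun j _ => ?_
    simp [hA]
    ring
  rw [charFunDual_apply, charFunDual_apply]
  simp_rw [hL]
  exact (h A).trans (integral_cexp_re_trace_gueMeasure A).symm

lemma measurable_conjTranspose_mul_mul {n k : ℕ} (P : Matrix (Fin n) (Fin k) ℂ) :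
    Measurable fun M : Matrix (Fin n) (Fin n) ℂ => Pᴴ * M * P := by
  refine measurable_matrix_iff fun i j => ?_
  simp only [mul_apply]
  refine Finset.measurable_fun_sum _ fun a _ => Measurable.mul_const
    (Finset.measurable_fun_sum _ fun b _ => ?_) _
  exact measurable_const.mul (measurable_entry b a)

lemma hermNormSq_conj {n k : ℕ} {P : Matrix (Fin n) (Fin k) ℂ} (hP : Pᴴ * P = 1)
    (A : Matrix (Fin k) (Fin k) ℂ) : hermNormSq (P * A * Pᴴ) = hermNormSq A := by
  have key : ∀ B C : Matrix (Fin k) (Fin k) ℂ,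
      (P * B * Pᴴ * (P * C * Pᴴ)).trace = (B * C).trace := by
    intro B C
    have : P * B * Pᴴ * (P * C * Pᴴ) = P * (B * (Pᴴ * P) * C * Pᴴ) := by
      simp only [Matrix.mul_assoc]
    rw [this, hP, Matrix.mul_one, trace_mul_comm, Matrix.mul_assoc, hP, Matrix.mul_one]
  have h2 : (P * A * Pᴴ)ᴴ = P * Aᴴ * Pᴴ := by
    simp only [conjTranspose_mul, conjTranspose_conjTranspose, Matrix.mul_assoc]
  rw [hermNormSq, hermNormSq, h2, key, key]

/-- The compression of a GUE matrix along an isometry is again a GUE matrix. -/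
theorem gueMeasure_map_compression {n k : ℕ} {P : Matrix (Fin n) (Fin k) ℂ} (hP : Pᴴ * P = 1) :
    (gueMeasure n).map (fun M => Pᴴ * M * P) = gueMeasure k := by
  have hm := measurable_conjTranspose_mul_mul P
  have := Measure.isProbabilityMeasure_map (μ := gueMeasure n) hm.aemeasurable
  refine eq_gueMeasure_of_integral_cexp _ fun A => ?_
  rw [integral_map hm.aemeasurable (measurable_cexp_re_trace_mul A).aestronglyMeasurable,
    ← hermNormSq_conj hP, ← integral_cexp_re_trace_gueMeasure]
  congr 1 with M
  rw [← Matrix.mul_assoc, trace_mul_comm]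
  simp only [Matrix.mul_assoc]

lemma measurable_matrix_neg {n : ℕ} : Measurable fun M : Matrix (Fin n) (Fin n) ℂ => -M :=
  measurable_matrix_iff fun i j => (measurable_entry i j).neg

theorem gueMeasure_map_neg (n : ℕ) : (gueMeasure n).map (fun M => -M) = gueMeasure n := by
  have hm := measurable_matrix_neg (n := n)
  have := Measure.isProbabilityMeasure_map (μ := gueMeasure n) hm.aemeasurable
  refine eq_gueMeasure_of_integral_cexp _ fun A => ?_
  rw [integral_map hm.aemeasurable (measurable_cexp_re_trace_mul A).aestronglyMeasurable]
  have : hermNormSq A = hermNormSq (-A) := by simp [hermNormSq]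
  rw [this, ← integral_cexp_re_trace_gueMeasure]
  simp

/-- The standard complex Gaussian distribution on `ℂ`. -/
def complexGaussian : Measure ℂ :=
  ((gaussianReal 0 (1 / 2)).prod (gaussianReal 0 (1 / 2))).map
    (fun p : ℝ × ℝ => (p.1 : ℂ) + (p.2 : ℂ) * I)

instance : IsProbabilityMeasure complexGaussian :=
  Measure.isProbabilityMeasure_map (Measurable.aemeasurable (by fun_prop))

/-- The standard complex Gaussian distribution on `ℂ^k`. -/
def complexGaussianPi (k : ℕ) : Measure (Fin k → ℂ) := Measure.pi fun _ => complexGaussian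

instance (k : ℕ) : IsProbabilityMeasure (complexGaussianPi k) := by
  unfold complexGaussianPi; infer_instance

lemma integral_cexp_complexGaussian (c : ℂ) :
    ∫ z, cexp (((c * z).re : ℝ) * I) ∂complexGaussian = cexp (-(normSq c / 4 : ℝ)) := by
  rw [complexGaussian, integral_map (Measurable.aemeasurable (by fun_prop))
    (Measurable.aestronglyMeasurable (by fun_prop))]
  have : ∀ p : ℝ × ℝ, cexp (((c * ((p.1 : ℂ) + (p.2 : ℂ) * I)).re : ℝ) * I) =
      cexp ((c.re * p.1 : ℝ) * I) * cexp ((-c.im * p.2 : ℝ) * I) := by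
    intro p
    rw [← Complex.exp_add, ← add_mul, ← Complex.ofReal_add]
    congr 3
    simp
    ring
  simp_rw [this]
  rw [integral_prod_mul (f := fun x : ℝ => cexp ((c.re * x : ℝ) * I))
    (g := fun x : ℝ => cexp ((-c.im * x : ℝ) * I)), integral_cexp_gaussianReal,
    integral_cexp_gaussianReal, ← Complex.exp_add]
  congr 1
  rw [normSq_apply]
  push_cast
  ring

lemma integral_cexp_complexGaussianPi {k : ℕ} (c : Fin k → ℂ) :
    ∫ v, cexp (((∑ i, c i * v i).re : ℝ) * I) ∂(complexGaussianPi k) =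
      cexp (-((∑ i, normSq (c i)) / 4 : ℝ)) := by
  have : ∀ v : Fin k → ℂ, cexp (((∑ i, c i * v i).re : ℝ) * I) =
      ∏ i, cexp (((c i * v i).re : ℝ) * I) := by
    intro v
    rw [← Complex.exp_sum, re_sum, Complex.ofReal_sum, Finset.sum_mul]
  simp_rw [this]
  rw [complexGaussianPi, integral_fintype_prod_eq_prod
    (f := fun i (z : ℂ) => cexp (((c i * z).re : ℝ) * I))]
  simp_rw [integral_cexp_complexGaussian]
  rw [← Complex.exp_sum, Finset.sum_neg_distrib, ← Complex.ofReal_sum, Finset.sum_div]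

/-- The matrix with first diagonal entry `a`, first column `v` below it, the conjugate transpose
as first row, and lower right block `M`. -/
def borderedMatrix {k : ℕ} (a : ℝ) (v : Fin k → ℂ) (M : Matrix (Fin k) (Fin k) ℂ) :
    Matrix (Fin (k + 1)) (Fin (k + 1)) ℂ :=
  Matrix.of (Fin.cons (Fin.cons (a : ℂ) fun j => star (v j)) fun i => Fin.cons (v i) (M i))

@[simp] lemma borderedMatrix_zero_zero {k : ℕ} (a : ℝ) (v : Fin k → ℂ)
    (M : Matrix (Fin k) (Fin k) ℂ) : borderedMatrix a v M 0 0 = a := rfl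

@[simp] lemma borderedMatrix_zero_succ {k : ℕ} (a : ℝ) (v : Fin k → ℂ)
    (M : Matrix (Fin k) (Fin k) ℂ) (j : Fin k) :
    borderedMatrix a v M 0 j.succ = star (v j) := rfl

@[simp] lemma borderedMatrix_succ_zero {k : ℕ} (a : ℝ) (v : Fin k → ℂ)
    (M : Matrix (Fin k) (Fin k) ℂ) (i : Fin k) :
    borderedMatrix a v M i.succ 0 = v i := rfl

@[simp] lemma borderedMatrix_succ_succ {k : ℕ} (a : ℝ) (v : Fin k → ℂ)
    (M : Matrix (Fin k) (Fin k) ℂ) (i j : Fin k) :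
    borderedMatrix a v M i.succ j.succ = M i j := rfl

lemma measurable_borderedMatrix (k : ℕ) :
    Measurable fun p : (ℝ × (Fin k → ℂ)) × Matrix (Fin k) (Fin k) ℂ =>
      borderedMatrix p.1.1 p.1.2 p.2 := by
  refine measurable_matrix_iff fun i j => ?_
  refine Fin.cases ?_ (fun i => ?_) i <;> refine Fin.cases ?_ (fun j => ?_) j
  · simp only [borderedMatrix_zero_zero]; fun_prop
  · simp only [borderedMatrix_zero_succ]; fun_prop
  · simp only [borderedMatrix_succ_zero]; fun_prop
  · simp only [borderedMatrix_succ_succ]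
    exact (measurable_entry i j).comp measurable_snd

/-- The GUE in dimension `k + 1` is obtained by bordering the GUE in dimension `k`. -/
theorem gueMeasure_succ (k : ℕ) :
    (((gaussianReal 0 1).prod (complexGaussianPi k)).prod (gueMeasure k)).map
      (fun p => borderedMatrix p.1.1 p.1.2 p.2) = gueMeasure (k + 1) := by
  have hm := measurable_borderedMatrix k
  have := Measure.isProbabilityMeasure_map
    (μ := ((gaussianReal 0 1).prod (complexGaussianPi k)).prod (gueMeasure k)) hm.aemeasurable
  refine eq_gueMeasure_of_integral_cexp _ fun A => ?_
  rw [integral_map hm.aemeasurable (measurable_cexp_re_trace_mul A).aestronglyMeasurable]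
  set c : Fin k → ℂ := fun i => A 0 i.succ + star (A i.succ 0) with hc
  set B : Matrix (Fin k) (Fin k) ℂ := A.submatrix Fin.succ Fin.succ with hB
  have key : ∀ p : (ℝ × (Fin k → ℂ)) × Matrix (Fin k) (Fin k) ℂ,
      cexp (((A * borderedMatrix p.1.1 p.1.2 p.2).trace.re : ℝ) * I) =
      (cexp (((A 0 0).re * p.1.1 : ℝ) * I) * cexp (((∑ i, c i * p.1.2 i).re : ℝ) * I)) *
        cexp (((B * p.2).trace.re : ℝ) * I) := by
    intro p
    rw [← Complex.exp_add, ← Complex.exp_add, ← add_mul, ← add_mul, ← Complex.ofReal_add,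
      ← Complex.ofReal_add]
    congr 3
    simp only [trace, diag, mul_apply, Fin.sum_univ_succ, re_sum, Complex.add_re,
      borderedMatrix_zero_zero, borderedMatrix_zero_succ, borderedMatrix_succ_zero,
      borderedMatrix_succ_succ, hc, hB, submatrix_apply, Finset.sum_add_distrib, add_mul]
    simp only [Complex.mul_re, star_def, conj_re, conj_im, ofReal_re, ofReal_im]
    simp only [mul_zero, sub_zero, mul_neg, sub_neg_eq_add, neg_mul]
    ring
  simp_rw [key]
  rw [integral_prod_mul
    (f := fun q : ℝ × (Fin k → ℂ) => cexp (((A 0 0).re * q.1 : ℝ) * I) *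
      cexp (((∑ i, c i * q.2 i).re : ℝ) * I))
    (g := fun M : Matrix (Fin k) (Fin k) ℂ => cexp (((B * M).trace.re : ℝ) * I)),
    integral_prod_mul (f := fun x : ℝ => cexp (((A 0 0).re * x : ℝ) * I))
      (g := fun v : Fin k → ℂ => cexp (((∑ i, c i * v i).re : ℝ) * I)),
    integral_cexp_gaussianReal, integral_cexp_complexGaussianPi,
    integral_cexp_re_trace_gueMeasure, ← Complex.exp_add, ← Complex.exp_add]
  congr 1
  rw [← Complex.ofReal_neg, ← Complex.ofReal_neg, ← Complex.ofReal_neg, ← Complex.ofReal_neg,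
    ← Complex.ofReal_add, ← Complex.ofReal_add]
  congr 1
  rw [hermNormSq_eq_sum, hermNormSq_eq_sum]
  simp only [Fin.sum_univ_succ, Finset.sum_add_distrib, hB, submatrix_apply, hc, normSq_apply]
  have e : ∑ i : Fin k, ((A 0 i.succ + star (A i.succ 0)).re * (A 0 i.succ + star (A i.succ 0)).re +
      (A 0 i.succ + star (A i.succ 0)).im * (A 0 i.succ + star (A i.succ 0)).im) =
      2 * (∑ i : Fin k, (((A 0 i.succ).re ^ 2 + (A 0 i.succ).im ^ 2) +
        ((A 0 i.succ).re * (A i.succ 0).re - (A 0 i.succ).im * (A i.succ 0).im)) / 2) +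
      2 * ∑ i : Fin k, (((A i.succ 0).re ^ 2 + (A i.succ 0).im ^ 2) +
        ((A i.succ 0).re * (A 0 i.succ).re - (A i.succ 0).im * (A 0 i.succ).im)) / 2 := by
    rw [Finset.mul_sum, Finset.mul_sum, ← Finset.sum_add_distrib]
    refine Finset.sum_congr rfl fun i _ => ?_
    simp
    ring
  simp only [Finset.sum_add_distrib] at e
  rw [e]
  push_cast
  ring

/-- The quadratic form `x ↦ Re ⟨x, M x⟩`. -/
def quadForm {k : ℕ} (M : Matrix (Fin k) (Fin k) ℂ) (x : Fin k → ℂ) : ℝ :=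
  (star x ⬝ᵥ M *ᵥ x).re

/-- The squared Euclidean norm. -/
def sqNorm {k : ℕ} (x : Fin k → ℂ) : ℝ := ∑ i, normSq (x i)

lemma sqNorm_nonneg {k : ℕ} (x : Fin k → ℂ) : 0 ≤ sqNorm x :=
  Finset.sum_nonneg fun _ _ => normSq_nonneg _

lemma sqNorm_eq_re {k : ℕ} (x : Fin k → ℂ) : sqNorm x = (star x ⬝ᵥ x).re := by
  simp [sqNorm, dotProduct, normSq_apply]

lemma sqNorm_pos {k : ℕ} {x : Fin k → ℂ} (hx : x ≠ 0) : 0 < sqNorm x := by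
  obtain ⟨i, hi⟩ := Function.ne_iff.mp hx
  exact Finset.sum_pos' (fun _ _ => normSq_nonneg _) ⟨i, Finset.mem_univ _, normSq_pos.mpr hi⟩

/-- The matrix `M + w wᴴ` is smaller than `s` as a quadratic form. -/
def FormLT {k : ℕ} (s : ℝ) (M : Matrix (Fin k) (Fin k) ℂ) (w : Fin k → ℂ) : Prop :=
  ∀ x : Fin k → ℂ, x ≠ 0 → quadForm M x + normSq (star w ⬝ᵥ x) < s * sqNorm x

lemma quadForm_conj {n k : ℕ} (P : Matrix (Fin n) (Fin k) ℂ) (M : Matrix (Fin n) (Fin n) ℂ)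
    (x : Fin k → ℂ) : quadForm (Pᴴ * M * P) x = quadForm M (P *ᵥ x) := by
  rw [quadForm, quadForm, star_mulVec, ← mulVec_mulVec, ← mulVec_mulVec, dotProduct_mulVec]

lemma sqNorm_mulVec {n k : ℕ} {P : Matrix (Fin n) (Fin k) ℂ} (hP : Pᴴ * P = 1)
    (x : Fin k → ℂ) : sqNorm (P *ᵥ x) = sqNorm x := by
  rw [sqNorm_eq_re, sqNorm_eq_re, star_mulVec, ← dotProduct_mulVec, mulVec_mulVec, hP, one_mulVec]

lemma formLT_conj_iff {k : ℕ} {U : Matrix (Fin k) (Fin k) ℂ} (hU : Uᴴ * U = 1) (s : ℝ)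
    (M : Matrix (Fin k) (Fin k) ℂ) (w : Fin k → ℂ) :
    FormLT s (Uᴴ * M * U) (Uᴴ *ᵥ w) ↔ FormLT s M w := by
  have hU' : U * Uᴴ = 1 := mul_eq_one_comm.mp hU
  have key : ∀ x, quadForm (Uᴴ * M * U) x + normSq (star (Uᴴ *ᵥ w) ⬝ᵥ x) =
      quadForm M (U *ᵥ x) + normSq (star w ⬝ᵥ (U *ᵥ x)) := by
    intro x
    rw [quadForm_conj, star_mulVec, conjTranspose_conjTranspose, ← dotProduct_mulVec]
  constructor
  · intro h x hx
    have h0 : U *ᵥ (Uᴴ *ᵥ x) = x := by rw [mulVec_mulVec, hU', one_mulVec]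
    have hx' : Uᴴ *ᵥ x ≠ 0 := by
      intro h1
      rw [h1, mulVec_zero] at h0
      exact hx h0.symm
    have := h _ hx'
    rwa [key, h0, ← sqNorm_mulVec hU (Uᴴ *ᵥ x), h0] at this
  · intro h x hx
    have h0 : Uᴴ *ᵥ (U *ᵥ x) = x := by rw [mulVec_mulVec, hU, one_mulVec]
    have hx' : U *ᵥ x ≠ 0 := by
      intro h1
      rw [h1, mulVec_zero] at h0
      exact hx h0.symm
    have := h _ hx'
    rwa [key, ← sqNorm_mulVec hU x]

lemma quadForm_smul {k : ℕ} (M : Matrix (Fin k) (Fin k) ℂ) (c : ℝ) (x : Fin k → ℂ) :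
    quadForm M ((c : ℂ) • x) = c ^ 2 * quadForm M x := by
  simp only [quadForm, star_smul, mulVec_smul, smul_dotProduct, dotProduct_smul, star_def,
    conj_ofReal, smul_eq_mul, ← mul_assoc, ← Complex.ofReal_mul, re_ofReal_mul]
  ring

lemma sqNorm_smul {k : ℕ} (c : ℝ) (x : Fin k → ℂ) :
    sqNorm ((c : ℂ) • x) = c ^ 2 * sqNorm x := by
  simp only [sqNorm, Pi.smul_apply, smul_eq_mul, normSq_mul, normSq_ofReal, Finset.mul_sum, sq]

lemma formLT_iff_sphere {k : ℕ} (s : ℝ) (M : Matrix (Fin k) (Fin k) ℂ) (w : Fin k → ℂ) :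
    FormLT s M w ↔ ∀ x ∈ Metric.sphere (0 : Fin k → ℂ) 1,
      quadForm M x + normSq (star w ⬝ᵥ x) < s * sqNorm x := by
  constructor
  · intro h x hx
    refine h x ?_
    rintro rfl
    simp at hx
  · intro h x hx
    have hn : 0 < ‖x‖ := norm_pos_iff.mpr hx
    have := h (((‖x‖⁻¹ : ℝ) : ℂ) • x) (by
      rw [mem_sphere_zero_iff_norm, norm_smul, Complex.norm_real, norm_inv, norm_norm,
        inv_mul_cancel₀ hn.ne'])
    rw [quadForm_smul, sqNorm_smul, dotProduct_smul, smul_eq_mul, normSq_mul, normSq_ofReal] at this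
    have h2 : 0 < ‖x‖⁻¹ ^ 2 := by positivity
    nlinarith

lemma measurableSet_formLT {k : ℕ} (s : ℝ) (w : Fin k → ℂ) :
    MeasurableSet {M : Matrix (Fin k) (Fin k) ℂ | FormLT s M w} := by
  suffices h : IsOpen {M : Fin k → Fin k → ℂ | FormLT s (Matrix.of M) w} from h.measurableSet
  simp_rw [formLT_iff_sphere]
  rw [isOpen_iff_mem_nhds]
  intro M hM
  refine (isCompact_sphere (0 : Fin k → ℂ) 1).eventually_forall_of_forall_eventually
    (P := fun M x => quadForm (Matrix.of M) x + normSq (star w ⬝ᵥ x) < s * sqNorm x) ?_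
  intro x hx
  refine IsOpen.mem_nhds (isOpen_lt ?_ ?_) (hM x hx)
  · simp only [quadForm, dotProduct, mulVec, of_apply, Pi.star_apply]
    have := Complex.continuous_normSq
    fun_prop
  · simp only [sqNorm]
    have := Complex.continuous_normSq
    fun_prop

lemma exists_unitary_mulVec_eq {k : ℕ} (w : Fin (k + 1) → ℂ) :
    ∃ U : Matrix (Fin (k + 1)) (Fin (k + 1)) ℂ, Uᴴ * U = 1 ∧
      Uᴴ *ᵥ w = Pi.single 0 ((√(sqNorm w) : ℝ) : ℂ) := by
  by_cases hw : w = 0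
  · refine ⟨1, by simp, ?_⟩
    subst hw
    simp [sqNorm]
  have hpos := sqNorm_pos hw
  set r : ℝ := √(sqNorm w) with hr
  have hr0 : 0 < r := Real.sqrt_pos.mpr hpos
  have hrr : r * r = sqNorm w := Real.mul_self_sqrt hpos.le
  set u : EuclideanSpace ℂ (Fin (k + 1)) := WithLp.toLp 2 (((r⁻¹ : ℝ) : ℂ) • w) with hu
  have hnorm : ‖u‖ = 1 := by
    rw [EuclideanSpace.norm_eq]
    have : ∑ i, ‖u i‖ ^ 2 = sqNorm (((r⁻¹ : ℝ) : ℂ) • w) := by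
      simp only [sqNorm, hu, normSq_eq_norm_sq]
    rw [this, sqNorm_smul, ← hrr]
    rw [show r⁻¹ ^ 2 * (r * r) = 1 by field_simp]
    simp
  obtain ⟨b, hb⟩ := Orthonormal.exists_orthonormalBasis_extension_of_card_eq (𝕜 := ℂ)
    (E := EuclideanSpace ℂ (Fin (k + 1))) (ι := Fin (k + 1)) (by simp) (v := fun _ => u)
    (s := {0}) (by
      constructor
      · intro i; exact hnorm
      · intro i j hij
        exact absurd (Subsingleton.elim i j) hij)
  refine ⟨Matrix.of fun i j => b j i, ?_, ?_⟩
  · ext i j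
    have := orthonormal_iff_ite.mp b.orthonormal i j
    rw [EuclideanSpace.inner_eq_star_dotProduct] at this
    simp only [mul_apply, conjTranspose_apply, of_apply, one_apply]
    rw [← this]
    simp [dotProduct, mul_comm]
  · ext i
    have h0 : b 0 = u := hb 0 (by simp)
    have hw' : w = fun j => (r : ℂ) * b 0 j := by
      ext j
      rw [h0, hu]
      simp only [Pi.smul_apply, smul_eq_mul, ← mul_assoc, ← Complex.ofReal_mul]
      rw [mul_inv_cancel₀ hr0.ne']
      simp
    have := orthonormal_iff_ite.mp b.orthonormal i 0
    rw [EuclideanSpace.inner_eq_star_dotProduct] at this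
    have h2 : ((Matrix.of fun i j => b j i)ᴴ *ᵥ w) i = (r : ℂ) * (if i = 0 then 1 else 0) := by
      rw [← this, hw']
      simp only [mulVec, dotProduct, conjTranspose_apply, of_apply, Finset.mul_sum]
      refine Finset.sum_congr rfl fun j _ => ?_
      simp
      ring
    rw [h2]
    by_cases hi : i = 0
    · subst hi; simp
    · simp [hi]

lemma gueMeasure_formLT_eq {k : ℕ} (s : ℝ) (w : Fin (k + 1) → ℂ) :
    gueMeasure (k + 1) {M | FormLT s M w} =
      gueMeasure (k + 1) {M | FormLT s M (Pi.single 0 ((√(sqNorm w) : ℝ) : ℂ))} := by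
  obtain ⟨U, hU, hw⟩ := exists_unitary_mulVec_eq w
  rw [← hw]
  conv_rhs => rw [← gueMeasure_map_compression hU,
    Measure.map_apply (measurable_conjTranspose_mul_mul U) (measurableSet_formLT _ _)]
  simp only [Set.preimage_ofPred_eq, formLT_conj_iff hU]

lemma sqNorm_cons {k : ℕ} (x₀ : ℂ) (x : Fin k → ℂ) :
    sqNorm (Fin.cons x₀ x : Fin (k + 1) → ℂ) = normSq x₀ + sqNorm x := by
  simp [sqNorm, Fin.sum_univ_succ]

lemma quadForm_borderedMatrix {k : ℕ} (a : ℝ) (v : Fin k → ℂ) (M : Matrix (Fin k) (Fin k) ℂ)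
    (x₀ : ℂ) (x : Fin k → ℂ) :
    quadForm (borderedMatrix a v M) (Fin.cons x₀ x) =
      a * normSq x₀ + 2 * (star x₀ * (star v ⬝ᵥ x)).re + quadForm M x := by
  have h1 : (star (Fin.cons x₀ x : Fin (k + 1) → ℂ) ⬝ᵥ borderedMatrix a v M *ᵥ (Fin.cons x₀ x)) =
      a * (star x₀ * x₀) + star x₀ * (star v ⬝ᵥ x) + star (star x₀ * (star v ⬝ᵥ x)) +
        star x ⬝ᵥ M *ᵥ x := by
    simp only [dotProduct, mulVec, Fin.sum_univ_succ, Pi.star_apply, Fin.cons_zero, Fin.cons_succ,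
      borderedMatrix_zero_zero, borderedMatrix_zero_succ, borderedMatrix_succ_zero,
      borderedMatrix_succ_succ, star_mul', star_sum, star_star, mul_add, Finset.mul_sum,
      Finset.sum_add_distrib]
    have e : ∀ i : Fin k, star (x i) * (v i * x₀) = x₀ * (v i * star (x i)) := fun i => by ring
    simp only [e]
    ring
  rw [quadForm, h1, quadForm]
  simp only [Complex.add_re, star_def, conj_re, re_ofReal_mul, normSq_apply]
  simp [Complex.mul_re]
  ring

/-- Schur complement: the positivity of `s - M` for a bordered matrix. -/
lemma formLT_borderedMatrix_iff {k : ℕ} (s a γ : ℝ) (hγ : 0 ≤ γ) (v : Fin k → ℂ)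
    (M : Matrix (Fin k) (Fin k) ℂ) :
    FormLT s (borderedMatrix a v M) (Pi.single 0 ((√γ : ℝ) : ℂ)) ↔
      a + γ < s ∧ FormLT s M ((((√(s - a - γ))⁻¹ : ℝ) : ℂ) • v) := by
  have hform : ∀ (x₀ : ℂ) (x : Fin k → ℂ),
      quadForm (borderedMatrix a v M) (Fin.cons x₀ x) +
        normSq (star (Pi.single 0 ((√γ : ℝ) : ℂ) : Fin (k + 1) → ℂ) ⬝ᵥ Fin.cons x₀ x) =
      (a + γ) * normSq x₀ + 2 * (star x₀ * (star v ⬝ᵥ x)).re + quadForm M x := by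
    intro x₀ x
    have : star (Pi.single 0 ((√γ : ℝ) : ℂ) : Fin (k + 1) → ℂ) ⬝ᵥ Fin.cons x₀ x =
        ((√γ : ℝ) : ℂ) * x₀ := by
      simp [dotProduct, Fin.sum_univ_succ]
    rw [this, quadForm_borderedMatrix, normSq_mul, normSq_ofReal, Real.mul_self_sqrt hγ]
    ring
  have hsq : ∀ (d : ℝ), 0 < d → ∀ (x₀ z : ℂ), d * normSq x₀ - 2 * (star x₀ * z).re =
      d * normSq (x₀ - z / d) - normSq z / d := by
    intro d hd x₀ z
    have : normSq (x₀ - z / d) = normSq x₀ - 2 * (star x₀ * z).re / d + normSq z / d ^ 2 := by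
      simp only [normSq_apply, Complex.sub_re, Complex.sub_im, Complex.div_ofReal_re,
        Complex.div_ofReal_im, Complex.mul_re, star_def, conj_re, conj_im]
      field_simp
      ring
    rw [this]
    field_simp
    ring
  have hw : ∀ x : Fin k → ℂ, a + γ < s →
      normSq (star ((((√(s - a - γ))⁻¹ : ℝ) : ℂ) • v) ⬝ᵥ x) =
        normSq (star v ⬝ᵥ x) / (s - a - γ) := by
    intro x h
    rw [star_smul, smul_dotProduct, smul_eq_mul, normSq_mul, star_def, conj_ofReal, normSq_ofReal,
      ← mul_inv, Real.mul_self_sqrt (by linarith)]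
    ring
  constructor
  · intro h
    have h1 : a + γ < s := by
      have := h (Fin.cons 1 0) (fun h0 => by simpa using congrFun h0 0)
      rw [hform, sqNorm_cons] at this
      simpa [sqNorm, quadForm] using this
    refine ⟨h1, fun x hx => ?_⟩
    have hd : 0 < s - a - γ := by linarith
    have h2 := h (Fin.cons ((star v ⬝ᵥ x) / ((s - a - γ : ℝ) : ℂ)) x) (fun h0 => hx (by
      ext i; simpa using congrFun h0 i.succ))
    have h3 := hsq _ hd ((star v ⬝ᵥ x) / ((s - a - γ : ℝ) : ℂ)) (star v ⬝ᵥ x)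
    rw [sub_self, map_zero, mul_zero] at h3
    rw [hform, sqNorm_cons] at h2
    rw [hw x h1]
    linarith
  · rintro ⟨h1, h⟩ y hy
    have hd : 0 < s - a - γ := by linarith
    obtain ⟨x₀, x, rfl⟩ : ∃ x₀ x, y = Fin.cons x₀ x := ⟨y 0, Fin.tail y, (Fin.cons_self_tail y).symm⟩
    rw [hform, sqNorm_cons]
    have := hsq _ hd x₀ (star v ⬝ᵥ x)
    by_cases hx : x = 0
    · subst hx
      have hx0 : x₀ ≠ 0 := by
        rintro rfl
        exact hy (by ext i; refine Fin.cases ?_ (fun i => ?_) i <;> simp)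
      have := normSq_pos.mpr hx0
      simp [quadForm, sqNorm]
      nlinarith
    · have h2 := h x hx
      rw [hw x h1] at h2
      have h3 := normSq_nonneg (x₀ - (star v ⬝ᵥ x) / ((s - a - γ : ℝ) : ℂ))
      nlinarith [mul_nonneg hd.le h3]

/-- The elimination process for the Jacobi matrix with diagonal entries `(x i).1` and squared
off-diagonal entries `(x i).2` has only positive pivots. -/
def ChainSurvives (s : ℝ) : (k : ℕ) → ℝ → (Fin k → ℝ × ℝ) → Prop
  | 0, _, _ => True
  | k + 1, γ, x => (x 0).1 + γ < s ∧ ChainSurvives s k ((x 0).2 / (s - (x 0).1 - γ)) (Fin.tail x)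

lemma measurableSet_chainSurvives (s : ℝ) (k : ℕ) :
    MeasurableSet {p : ℝ × (Fin k → ℝ × ℝ) | ChainSurvives s k p.1 p.2} := by
  induction k with
  | zero => simp [ChainSurvives]
  | succ k ih =>
    have h1 : MeasurableSet {p : ℝ × (Fin (k + 1) → ℝ × ℝ) | (p.2 0).1 + p.1 < s} :=
      measurableSet_lt (by fun_prop) (by fun_prop)
    have h2 : Measurable fun p : ℝ × (Fin (k + 1) → ℝ × ℝ) =>
        ((p.2 0).2 / (s - (p.2 0).1 - p.1), (Fin.tail p.2 : Fin k → ℝ × ℝ)) := by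
      unfold Fin.tail
      fun_prop
    exact h1.inter (h2 ih)

/-- The law of a diagonal entry and of the squared norm of the rest of its row, with `d` entries. -/
def rowLaw (d : ℕ) : Measure (ℝ × ℝ) :=
  ((gaussianReal 0 1).prod (complexGaussianPi d)).map (fun q => (q.1, sqNorm q.2))

lemma measurable_sqNorm (d : ℕ) : Measurable (sqNorm : (Fin d → ℂ) → ℝ) := by
  unfold sqNorm
  have := Complex.continuous_normSq.measurable
  fun_prop

lemma measurable_rowMap (d : ℕ) :
    Measurable fun q : ℝ × (Fin d → ℂ) => (q.1, sqNorm q.2) := by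
  have := measurable_sqNorm d
  fun_prop

instance (d : ℕ) : IsProbabilityMeasure (rowLaw d) :=
  Measure.isProbabilityMeasure_map (measurable_rowMap d).aemeasurable

/-- The law of the coefficients of the Jacobi matrix of a `k × k` GUE matrix. -/
def jacobiLaw (k : ℕ) : Measure (Fin k → ℝ × ℝ) := Measure.pi fun i => rowLaw (k - (i + 1))

instance (k : ℕ) : IsProbabilityMeasure (jacobiLaw k) := by unfold jacobiLaw; infer_instance

lemma jacobiLaw_succ_apply (k : ℕ) {S : Set (Fin (k + 1) → ℝ × ℝ)} (hS : MeasurableSet S) :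
    jacobiLaw (k + 1) S = ∫⁻ y, jacobiLaw k {x | Fin.cons y x ∈ S} ∂(rowLaw k) := by
  have h := (measurePreserving_piFinSuccAbove
    (fun i : Fin (k + 1) => rowLaw (k + 1 - (i + 1))) 0).symm
  have e : Measure.pi (fun j : Fin k => rowLaw (k + 1 - ((Fin.succAbove 0 j : Fin (k + 1)) + 1)))
      = jacobiLaw k := by
    unfold jacobiLaw
    congr 1
    ext1 j
    simp
  rw [e] at h
  simp only [Fin.val_zero, zero_add, Nat.add_sub_cancel] at h
  rw [jacobiLaw, ← h.measure_preimage hS.nullMeasurableSet,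
    Measure.prod_apply (h.measurable hS)]
  refine lintegral_congr fun y => ?_
  congr 1
  ext x
  simp only [Set.mem_preimage, Set.mem_ofPred_eq, MeasurableEquiv.piFinSuccAbove_symm_apply,
    Fin.insertNthEquiv, Fin.insertNth_zero, Equiv.coe_fn_mk]
  rfl

/-- The probability that `s - M - w wᴴ` is positive definite for a GUE matrix `M` is the
probability that the elimination process of the associated Jacobi matrix survives. -/
theorem gueMeasure_formLT (s : ℝ) (k : ℕ) (w : Fin k → ℂ) :
    gueMeasure k {M | FormLT s M w} = jacobiLaw k {x | ChainSurvives s k (sqNorm w) x} := by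
  induction k with
  | zero =>
    have h1 : {M : Matrix (Fin 0) (Fin 0) ℂ | FormLT s M w} = Set.univ := by
      ext M
      simp only [Set.mem_ofPred_eq, Set.mem_univ, iff_true]
      intro x hx
      exact absurd (Subsingleton.elim x 0) hx
    simp [h1, ChainSurvives]
  | succ k ih =>
    have hγ := sqNorm_nonneg w
    set γ := sqNorm w with hγdef
    have hmeas : MeasurableSet {x | ChainSurvives s (k + 1) γ x} :=
      (measurable_prodMk_left (x := γ)) (measurableSet_chainSurvives s (k + 1))
    have hmeas2 : MeasurableSet {p : (ℝ × ℝ) × (Fin k → ℝ × ℝ) |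
        ChainSurvives s (k + 1) γ (Fin.cons p.1 p.2)} := by
      have hc : Measurable fun p : (ℝ × ℝ) × (Fin k → ℝ × ℝ) =>
          (Fin.cons p.1 p.2 : Fin (k + 1) → ℝ × ℝ) := by
        refine measurable_pi_lambda _ fun i => ?_
        refine Fin.cases ?_ (fun i => ?_) i
        · simp only [Fin.cons_zero]; fun_prop
        · simp only [Fin.cons_succ]; fun_prop
      exact hc hmeas
    have hm : Measurable fun y : ℝ × ℝ =>
        jacobiLaw k {x | Fin.cons y x ∈ {x | ChainSurvives s (k + 1) γ x}} :=
      measurable_measure_prodMk_left hmeas2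
    rw [gueMeasure_formLT_eq, ← hγdef, jacobiLaw_succ_apply k hmeas, ← gueMeasure_succ,
      Measure.map_apply (measurable_borderedMatrix k) (measurableSet_formLT _ _),
      Measure.prod_apply (measurable_borderedMatrix k (measurableSet_formLT _ _)), rowLaw,
      lintegral_map hm (measurable_rowMap k)]
    refine lintegral_congr fun q => ?_
    simp only [Set.preimage_ofPred_eq, formLT_borderedMatrix_iff s _ γ hγ, ChainSurvives,
      Set.mem_ofPred_eq, Fin.cons_zero, Fin.tail_cons]
    by_cases h : q.1 + γ < s
    · simp only [h, true_and, ih, sqNorm_smul]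
      congr 2
      rw [inv_pow, Real.sq_sqrt (by linarith)]
      ring_nf
    · simp [h]

end

/-- The quadratic form of the Jacobi matrix with diagonal `a` and squared off-diagonal `b`. -/
def jacobiForm (k : ℕ) (a b y : ℕ → ℝ) : ℝ :=
  ∑ i ∈ Finset.range k, (a i * y i ^ 2 + 2 * √(b i) * (y i * y (i + 1)))

lemma jacobiForm_succ (k : ℕ) (a b y : ℕ → ℝ) :
    jacobiForm (k + 1) a b y = a 0 * y 0 ^ 2 + 2 * √(b 0) * (y 0 * y 1) +
      jacobiForm k (fun i => a (i + 1)) (fun i => b (i + 1)) (fun i => y (i + 1)) := by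
  rw [jacobiForm, Finset.sum_range_succ', add_comm]; rfl

lemma chainSurvives_iff (s : ℝ) (k : ℕ) : ∀ (γ : ℝ) (a b : ℕ → ℝ), (∀ i, 0 ≤ b i) →
    (ChainSurvives s k γ (fun i => (a i, b i)) ↔
      ∀ y : ℕ → ℝ, (∀ i, k ≤ i → y i = 0) → (∃ i, y i ≠ 0) →
        γ * y 0 ^ 2 + jacobiForm k a b y < s * ∑ i ∈ Finset.range k, y i ^ 2) := by
  induction k with
  | zero =>
    intro γ a b _
    simp only [ChainSurvives, true_iff]
    rintro y hy ⟨i, hi⟩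
    exact absurd (hy i (Nat.zero_le i)) hi
  | succ k ih =>
    intro γ a b hb
    have e : Fin.tail (fun i : Fin (k + 1) => (a i, b i)) =
        fun i : Fin k => (a (i + 1), b (i + 1)) := rfl
    simp only [ChainSurvives]
    rw [e, ih _ (fun i => a (i + 1)) (fun i => b (i + 1)) (fun i => hb _)]
    simp only [Fin.val_zero]
    have hsq := Real.sq_sqrt (hb 0)
    constructor
    · rintro ⟨h1, h2⟩ y hy hy0
      rw [jacobiForm_succ, Finset.sum_range_succ']
      have hδ : 0 < s - a 0 - γ := by linarith
      by_cases h : ∃ i, y (i + 1) ≠ 0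
      · have h3 := h2 (fun i => y (i + 1)) (fun i hi => hy _ (by omega)) h
        simp only [zero_add] at h3
        have h4 : 2 * √(b 0) * (y 0 * y 1) ≤ (s - a 0 - γ) * y 0 ^ 2 +
            b 0 / (s - a 0 - γ) * y 1 ^ 2 := by
          have : (s - a 0 - γ) * y 0 ^ 2 + b 0 / (s - a 0 - γ) * y 1 ^ 2 -
              2 * √(b 0) * (y 0 * y 1) =
              ((s - a 0 - γ) * y 0 - √(b 0) * y 1) ^ 2 / (s - a 0 - γ) := by
            field_simp
            rw [← hsq]; rw [Real.sqrt_sq (Real.sqrt_nonneg _)]; ring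
          have : 0 ≤ ((s - a 0 - γ) * y 0 - √(b 0) * y 1) ^ 2 / (s - a 0 - γ) := by positivity
          linarith
        linarith
      · push Not at h
        have hy00 : y 0 ≠ 0 := by
          obtain ⟨i, hi⟩ := hy0
          cases i with
          | zero => exact hi
          | succ i => exact absurd (h i) hi
        have : 0 < (s - a 0 - γ) * y 0 ^ 2 := by positivity
        simp only [jacobiForm, h]
        simp
        linarith
    · intro H
      have h1 : a 0 + γ < s := by
        have := H (fun i => if i = 0 then 1 else 0) (fun i hi => by simp; omega) ⟨0, by simp⟩
        rw [jacobiForm_succ, Finset.sum_range_succ'] at this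
        simp [jacobiForm] at this
        linarith
      refine ⟨h1, fun y hy hy0 => ?_⟩
      have hδ : 0 < s - a 0 - γ := by linarith
      have h3 := H (fun i => Nat.casesOn i (√(b 0) * y 0 / (s - a 0 - γ)) y)
        (fun i hi => by
          cases i with
          | zero => omega
          | succ i => exact hy i (by omega))
        (by obtain ⟨i, hi⟩ := hy0; exact ⟨i + 1, hi⟩)
      rw [jacobiForm_succ, Finset.sum_range_succ'] at h3
      change γ * (√(b 0) * y 0 / (s - a 0 - γ)) ^ 2 + (a 0 * (√(b 0) * y 0 / (s - a 0 - γ)) ^ 2 +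
        2 * √(b 0) * (√(b 0) * y 0 / (s - a 0 - γ) * y 0) +
        jacobiForm k (fun i => a (i + 1)) (fun i => b (i + 1)) y) <
        s * (∑ x ∈ Finset.range k, y x ^ 2 + (√(b 0) * y 0 / (s - a 0 - γ)) ^ 2) at h3
      have h4 : 2 * √(b 0) * (√(b 0) * y 0 / (s - a 0 - γ) * y 0) -
          (s - a 0 - γ) * (√(b 0) * y 0 / (s - a 0 - γ)) ^ 2 =
            b 0 / (s - a 0 - γ) * y 0 ^ 2 := by
        field_simp
        rw [hsq]; ring
      linarith

/-- The discounted partial sums `∑_{j < i} θ ^ (i - 1 - j) w_j`. -/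
def leakySum (θ : ℝ) (w : ℕ → ℝ) : ℕ → ℝ
  | 0 => 0
  | i + 1 => θ * leakySum θ w i + w i

lemma sum_mul_eq_leakySum (θ : ℝ) (w z : ℕ → ℝ) (k : ℕ) :
    ∑ i ∈ Finset.range k, w i * z i =
      ∑ i ∈ Finset.range k, leakySum θ w (i + 1) * (z i - θ * z (i + 1)) +
        θ * leakySum θ w k * z k := by
  induction k with
  | zero => simp [leakySum]
  | succ k ih =>
    rw [Finset.sum_range_succ, Finset.sum_range_succ, ih, leakySum]
    ring

lemma sum_range_succ_shift_le {z : ℕ → ℝ} {k : ℕ} (hz : ∀ i, 0 ≤ z i) (hk : z k = 0) :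
    ∑ i ∈ Finset.range k, z (i + 1) ≤ ∑ i ∈ Finset.range k, z i := by
  have h1 := Finset.sum_range_succ' z k
  have h2 := Finset.sum_range_succ z k
  have := hz 0
  linarith

lemma sum_mul_le_of_leakySum_le {θ B : ℝ} (hθ : θ ≤ 1) {w z : ℕ → ℝ} {k : ℕ}
    (hw : ∀ i < k, |leakySum θ w (i + 1)| ≤ B) (hz : ∀ i, 0 ≤ z i) (hk : z k = 0) :
    ∑ i ∈ Finset.range k, w i * z i ≤
      B * (∑ i ∈ Finset.range k, |z i - z (i + 1)| + (1 - θ) * ∑ i ∈ Finset.range k, z i) := by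
  rw [sum_mul_eq_leakySum θ, hk, mul_zero, add_zero]
  rcases Nat.eq_zero_or_pos k with rfl | hk0
  · simp
  have hB : 0 ≤ B := (abs_nonneg _).trans (hw 0 hk0)
  have h1 : ∀ i ∈ Finset.range k, leakySum θ w (i + 1) * (z i - θ * z (i + 1)) ≤
      B * (|z i - z (i + 1)| + (1 - θ) * z (i + 1)) := by
    intro i hi
    have h2 : |z i - θ * z (i + 1)| ≤ |z i - z (i + 1)| + (1 - θ) * z (i + 1) := by
      have : z i - θ * z (i + 1) = (z i - z (i + 1)) + (1 - θ) * z (i + 1) := by ring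
      rw [this]
      refine (abs_add_le _ _).trans ?_
      rw [abs_of_nonneg (mul_nonneg (sub_nonneg.2 hθ) (hz (i + 1)))]
    calc _ ≤ |leakySum θ w (i + 1) * (z i - θ * z (i + 1))| := le_abs_self _
      _ = |leakySum θ w (i + 1)| * |z i - θ * z (i + 1)| := abs_mul _ _
      _ ≤ _ := mul_le_mul (hw i (Finset.mem_range.1 hi)) h2 (abs_nonneg _) hB
  refine (Finset.sum_le_sum h1).trans ?_
  rw [← Finset.mul_sum, Finset.sum_add_distrib, ← Finset.mul_sum]
  have := sum_range_succ_shift_le hz hk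
  have h3 : 0 ≤ 1 - θ := sub_nonneg.2 hθ
  gcongr

lemma add_div_le_of_one_le {t r c : ℝ} (ht : 1 ≤ t) (htr : t ≤ r) (hc : 0 ≤ c) :
    t + c / t ≤ r + c / r + c ^ 4 / r ^ 3 := by
  have ht0 : 0 < t := by linarith
  have hr0 : 0 < r := by linarith
  have h4 : 0 ≤ c ^ 4 / r ^ 3 := by positivity
  rcases le_total c r with h | h
  · have : r + c / r - (t + c / t) = (r - t) * (r * t - c) / (r * t) := by
      field_simp
      ring
    have h2 : 0 ≤ (r - t) * (r * t - c) / (r * t) := by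
      apply div_nonneg (mul_nonneg (by linarith) _) (by positivity)
      nlinarith
    linarith
  · have h1 : c / t ≤ c := div_le_self hc ht
    have h2 : c ≤ c ^ 4 / r ^ 3 := by
      rw [le_div_iff₀ (by positivity)]
      calc c * r ^ 3 ≤ c * c ^ 3 := by gcongr
        _ = c ^ 4 := by ring
    have h3 : 0 ≤ c / r := by positivity
    linarith

lemma two_sqrt_mul_le {b D x y n : ℝ} (hb : 0 ≤ b) (hD : 0 < D)
    (hn : n = (b - (D - 1)) / (2 * √D)) :
    2 * √b * (x * y) ≤ (√D + n) * (x ^ 2 + y ^ 2) - √D / 2 * (|x| - |y|) ^ 2 := by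
  have hsD : 0 < √D := Real.sqrt_pos.2 hD
  have e1 := Real.sq_sqrt hD.le
  have e2 := Real.sq_sqrt hb
  have hx := sq_abs x
  have hy := sq_abs y
  set κ := (b + D) / (2 * √D) with hκ
  have h1 : √b ≤ κ := by
    rw [hκ, le_div_iff₀ (by positivity)]
    nlinarith [sq_nonneg (√b - √D)]
  have h2 : √D / 2 ≤ κ := by
    rw [hκ, le_div_iff₀ (by positivity)]
    nlinarith
  have h3 : κ = √D + n - 1 / (2 * √D) := by
    rw [hκ, hn]
    field_simp
    rw [e1]; ring
  have h4 : 0 < 1 / (2 * √D) := by positivity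
  have h5 : x * y ≤ |x| * |y| := by rw [← abs_mul]; exact le_abs_self _
  have h6 : 0 ≤ |x| * |y| := by positivity
  calc 2 * √b * (x * y) ≤ 2 * √b * (|x| * |y|) := by gcongr
    _ ≤ 2 * κ * (|x| * |y|) := by gcongr
    _ = κ * (x ^ 2 + y ^ 2) - κ * (|x| - |y|) ^ 2 := by rw [← hx, ← hy]; ring
    _ ≤ (√D + n) * (x ^ 2 + y ^ 2) - √D / 2 * (|x| - |y|) ^ 2 := by
      have : κ ≤ √D + n := by linarith
      gcongr

lemma abs_sq_sub_sq_le {B t x y : ℝ} (ht : 0 < t) :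
    3 * B * |x ^ 2 - y ^ 2| ≤ t / 2 * (|x| - |y|) ^ 2 + 9 * B ^ 2 / t * (x ^ 2 + y ^ 2) := by
  rw [← sq_abs x, ← sq_abs y]
  have hp : 0 ≤ |x| + |y| := by positivity
  generalize |x| = u at *
  generalize |y| = v at *
  have e : |u ^ 2 - v ^ 2| = |u - v| * (u + v) := by
    rw [sq_sub_sq, abs_mul, abs_of_nonneg hp, mul_comm]
  rw [e, ← sq_abs (u - v)]
  have h1 : 0 ≤ (t * |u - v| - 3 * B * (u + v)) ^ 2 / (2 * t) := by positivity
  have h2 : (t * |u - v| - 3 * B * (u + v)) ^ 2 / (2 * t) =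
      t / 2 * |u - v| ^ 2 + 9 * B ^ 2 / t * ((u + v) ^ 2 / 2) - 3 * B * (|u - v| * (u + v)) := by
    field_simp
    ring
  have h3 : (u + v) ^ 2 / 2 ≤ u ^ 2 + v ^ 2 := by nlinarith [sq_nonneg (u - v)]
  have h4 : 9 * B ^ 2 / t * ((u + v) ^ 2 / 2) ≤ 9 * B ^ 2 / t * (u ^ 2 + v ^ 2) := by gcongr
  linarith

/-- If the discounted sums of the noise in a Jacobi matrix are small then its quadratic form is
close to that of the deterministic limit. -/
theorem jacobiForm_le {k : ℕ} {q L : ℝ} (hq : 1 ≤ q) (hk : q ^ 6 = k) (hL : 1 ≤ L)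
    {a b : ℕ → ℝ} (hb : ∀ i, 0 ≤ b i)
    (ha : ∀ i < k, |leakySum (1 - 1 / q ^ 2) a (i + 1)| ≤ L * q)
    (hn : ∀ i < k, |leakySum (1 - 1 / q ^ 2)
      (fun i => (b i - ((k : ℝ) - i - 1)) / (2 * √((k : ℝ) - i))) (i + 1)| ≤ L * q)
    {y : ℕ → ℝ} (hy : ∀ i, k ≤ i → y i = 0) :
    jacobiForm k a b y ≤ (2 * q ^ 3 + 13143 * L ^ 8 / q) * ∑ i ∈ Finset.range k, y i ^ 2 := by
  have hq0 : 0 < q := by linarith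
  set θ := 1 - 1 / q ^ 2 with hθ
  have hθ1 : θ ≤ 1 := by
    have : 0 ≤ 1 / q ^ 2 := by positivity
    linarith
  set n : ℕ → ℝ := fun i => (b i - ((k : ℝ) - i - 1)) / (2 * √((k : ℝ) - i)) with hndef
  set B := L * q with hB
  set Q := ∑ i ∈ Finset.range k, y i ^ 2 with hQ
  set V := ∑ i ∈ Finset.range k, |y i ^ 2 - y (i + 1) ^ 2| with hV
  have hQ0 : 0 ≤ Q := Finset.sum_nonneg fun _ _ => sq_nonneg _
  have hB0 : 0 < B := by positivity
  have hyk : y k ^ 2 = 0 := by rw [hy k le_rfl]; simp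
  have hyk1 : y (k + 1) ^ 2 = 0 := by rw [hy (k + 1) (by omega)]; simp
  have h1 : ∑ i ∈ Finset.range k, a i * y i ^ 2 ≤ B * (V + (1 - θ) * Q) :=
    sum_mul_le_of_leakySum_le hθ1 ha (z := fun i => y i ^ 2) (fun _ => sq_nonneg _) hyk
  have h2 : ∑ i ∈ Finset.range k, n i * y i ^ 2 ≤ B * (V + (1 - θ) * Q) :=
    sum_mul_le_of_leakySum_le hθ1 hn (z := fun i => y i ^ 2) (fun _ => sq_nonneg _) hyk
  have hshift : ∑ i ∈ Finset.range k, y (i + 1) ^ 2 ≤ Q :=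
    sum_range_succ_shift_le (z := fun i => y i ^ 2) (fun _ => sq_nonneg _) hyk
  have h3 : ∑ i ∈ Finset.range k, n i * y (i + 1) ^ 2 ≤ B * (V + (1 - θ) * Q) := by
    refine (sum_mul_le_of_leakySum_le hθ1 hn (z := fun i => y (i + 1) ^ 2)
      (fun _ => sq_nonneg _) hyk1).trans ?_
    have h4 : ∑ i ∈ Finset.range k, |y (i + 1) ^ 2 - y (i + 1 + 1) ^ 2| ≤ V :=
      sum_range_succ_shift_le (z := fun i => |y i ^ 2 - y (i + 1) ^ 2|)
        (fun _ => abs_nonneg _) (by simp [hyk, hyk1])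
    have : 0 ≤ 1 - θ := by linarith
    gcongr
  have hD : ∀ i ∈ Finset.range k, 1 ≤ √((k : ℝ) - i) ∧ √((k : ℝ) - i) ≤ q ^ 3 := by
    intro i hi
    have : i + 1 ≤ k := Finset.mem_range.1 hi
    have : (i : ℝ) + 1 ≤ k := by exact_mod_cast this
    constructor
    · rw [Real.one_le_sqrt]; linarith
    · rw [Real.sqrt_le_left (by positivity)]
      have : (0 : ℝ) ≤ i := by positivity
      nlinarith
  have h5 : ∀ i ∈ Finset.range k, 2 * √(b i) * (y i * y (i + 1)) +
      3 * B * |y i ^ 2 - y (i + 1) ^ 2| ≤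
      (q ^ 3 + 9 * B ^ 2 / q ^ 3 + (9 * B ^ 2) ^ 4 / (q ^ 3) ^ 3) * (y i ^ 2 + y (i + 1) ^ 2) +
        (n i * y i ^ 2 + n i * y (i + 1) ^ 2) := by
    intro i hi
    obtain ⟨hD1, hD2⟩ := hD i hi
    have hs : 0 < √((k : ℝ) - i) := by linarith
    have h6 := two_sqrt_mul_le (x := y i) (y := y (i + 1)) (hb i) (Real.sqrt_pos.1 hs)
      (n := n i) rfl
    have h7 := abs_sq_sub_sq_le (B := B) (x := y i) (y := y (i + 1)) hs
    have h8 := mul_le_mul_of_nonneg_right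
      (add_div_le_of_one_le hD1 hD2 (c := 9 * B ^ 2) (by positivity))
      (add_nonneg (sq_nonneg (y i)) (sq_nonneg (y (i + 1))))
    linarith
  have h9 := Finset.sum_le_sum h5
  rw [Finset.sum_add_distrib, Finset.sum_add_distrib, ← Finset.mul_sum, ← Finset.mul_sum,
    Finset.sum_add_distrib, Finset.sum_add_distrib] at h9
  rw [jacobiForm, Finset.sum_add_distrib]
  have hX : q ^ 3 + 9 * B ^ 2 / q ^ 3 + (9 * B ^ 2) ^ 4 / (q ^ 3) ^ 3 =
      q ^ 3 + (9 * L ^ 2 + 6561 * L ^ 8) / q := by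
    rw [hB]; field_simp; ring
  rw [hX] at h9
  have h10 : (q ^ 3 + (9 * L ^ 2 + 6561 * L ^ 8) / q) *
      (∑ i ∈ Finset.range k, y i ^ 2 + ∑ i ∈ Finset.range k, y (i + 1) ^ 2) ≤
      (q ^ 3 + (9 * L ^ 2 + 6561 * L ^ 8) / q) * (2 * Q) := by
    gcongr
    linarith
  have h11 : 3 * B * ((1 - θ) * Q) = 3 * L / q * Q := by
    rw [hB, hθ]; field_simp; ring
  have h12 : (q ^ 3 + (9 * L ^ 2 + 6561 * L ^ 8) / q) * (2 * Q) + 3 * L / q * Q =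
      (2 * q ^ 3 + (18 * L ^ 2 + 13122 * L ^ 8 + 3 * L) / q) * Q := by
    field_simp
    ring
  have hL2 : L ^ 2 ≤ L ^ 8 := pow_le_pow_right₀ hL (by norm_num)
  have hL1 : L ≤ L ^ 8 := le_self_pow₀ hL (by norm_num)
  have h13 : (2 * q ^ 3 + (18 * L ^ 2 + 13122 * L ^ 8 + 3 * L) / q) * Q ≤
      (2 * q ^ 3 + 13143 * L ^ 8 / q) * Q := by
    gcongr
    linarith
  have h14 : 0 ≤ V := Finset.sum_nonneg fun _ _ => abs_nonneg _
  linarith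

/-- A parabolic profile supported on `{0, …, p - 1}`. -/
def parabola (p i : ℕ) : ℝ := ((i + 1) * (p - i) : ℕ)

lemma parabola_nonneg (p i : ℕ) : 0 ≤ parabola p i := Nat.cast_nonneg _

lemma parabola_eq_zero {p i : ℕ} (h : p ≤ i) : parabola p i = 0 := by
  simp [parabola, Nat.sub_eq_zero_of_le h]

lemma parabola_of_le {p i : ℕ} (h : i ≤ p) : parabola p i = ((i : ℝ) + 1) * (p - i) := by
  rw [parabola]; push_cast [Nat.cast_sub h]; ring

lemma parabola_le (p i : ℕ) : parabola p i ≤ (p : ℝ) ^ 2 := by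
  rcases le_total p i with h | h
  · rw [parabola_eq_zero h]; positivity
  · rw [parabola_of_le h]
    have h1 : (i : ℝ) ≤ p := by exact_mod_cast h
    have h2 : (0 : ℝ) ≤ i := by positivity
    rcases eq_or_lt_of_le h with h3 | h3
    · rw [h3]; nlinarith
    · have h4 : (i : ℝ) + 1 ≤ p := by exact_mod_cast h3
      nlinarith

lemma sum_range_quartic (c₀ c₁ c₂ c₃ c₄ : ℝ) (m : ℕ) :
    ∑ i ∈ Finset.range m, (c₀ + c₁ * i + c₂ * i ^ 2 + c₃ * i ^ 3 + c₄ * i ^ 4) =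
      c₀ * m + c₁ * (m * (m - 1) / 2) + c₂ * (m * (m - 1) * (2 * m - 1) / 6) +
        c₃ * (m * (m - 1) / 2) ^ 2 +
        c₄ * (m * (m - 1) * (2 * m - 1) * (3 * m ^ 2 - 3 * m - 1) / 30) := by
  induction m with
  | zero => simp
  | succ m ih =>
    rw [Finset.sum_range_succ, ih]
    push_cast
    ring

lemma sum_range_eq_of_support {p k : ℕ} (hpk : p ≤ k) {f : ℕ → ℝ} (hf : ∀ i, p ≤ i → f i = 0) :
    ∑ i ∈ Finset.range k, f i = ∑ i ∈ Finset.range p, f i :=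
  (Finset.sum_subset (Finset.range_subset_range.2 hpk)
    fun i _ hi => hf i (by simpa using hi)).symm

lemma sum_parabola_sq {p k : ℕ} (hpk : p ≤ k) :
    ∑ i ∈ Finset.range k, parabola p i ^ 2 = (((p : ℝ) + 1) ^ 5 - (p + 1)) / 30 := by
  rw [sum_range_eq_of_support hpk fun i hi => by simp [parabola_eq_zero hi]]
  have : ∀ i ∈ Finset.range p, parabola p i ^ 2 = (p : ℝ) ^ 2 + 2 * p * (p - 1) * i +
      (((p : ℝ) - 1) ^ 2 - 2 * p) * i ^ 2 + (-2 * ((p : ℝ) - 1)) * i ^ 3 + 1 * (i : ℝ) ^ 4 := by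
    intro i hi
    rw [parabola_of_le (Finset.mem_range.1 hi).le]
    ring
  rw [Finset.sum_congr rfl this, sum_range_quartic]
  ring

lemma two_mul_sum_parabola_mul {p k : ℕ} (hpk : p ≤ k) :
    2 * ∑ i ∈ Finset.range k, parabola p i * parabola p (i + 1) =
      2 * ((((p : ℝ) + 1) ^ 5 - (p + 1)) / 30) - (p + 1) * (((p : ℝ) + 1) ^ 2 - 1) / 3 := by
  rw [sum_range_eq_of_support hpk fun i hi => by simp [parabola_eq_zero hi]]
  have : ∀ i ∈ Finset.range p, parabola p i * parabola p (i + 1) =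
      2 * (p : ℝ) * (p - 1) + (p * (p - 3) + 2 * (p - 1) ^ 2) * i +
      (-p + ((p : ℝ) - 1) * (p - 3) - 2 * (p - 1)) * i ^ 2 +
      (-(((p : ℝ) - 1) + (p - 3))) * i ^ 3 + 1 * (i : ℝ) ^ 4 := by
    intro i hi
    rw [parabola_of_le (Finset.mem_range.1 hi).le,
      parabola_of_le (Nat.succ_le_of_lt (Finset.mem_range.1 hi))]
    push_cast
    ring
  rw [Finset.sum_congr rfl this, sum_range_quartic]
  ring

lemma one_add_half_sub_le_sqrt {x : ℝ} (hx : -1 ≤ x) : 1 + x / 2 - x ^ 2 / 2 ≤ √(1 + x) := by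
  have h := Real.sq_sqrt (show 0 ≤ 1 + x by linarith)
  set t := √(1 + x)
  have ht : 0 ≤ t := Real.sqrt_nonneg _
  have e : x = t ^ 2 - 1 := by linarith
  rw [e]
  nlinarith [mul_nonneg (sq_nonneg (t - 1)) (mul_nonneg ht (by linarith : 0 ≤ t + 2))]

lemma le_two_sqrt_mul {b k j r L z : ℝ} (hr : 0 < r) (hk : r ^ 2 = k) (hL : 1 ≤ L) (hb : 0 ≤ b)
    (hz : 0 ≤ z) (hjk : j ^ 2 ≤ k) (hbL : |b - (k - j)| ≤ 2 * L * r) :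
    2 * r * z + (b - (k - j)) / r * z - (j / r + 10 * L ^ 2 / r) * z ≤ 2 * √b * z := by
  have hk0 : 0 < k := by rw [← hk]; positivity
  set x := (b - k) / k with hx
  have hx1 : -1 ≤ x := by
    rw [hx, le_div_iff₀ hk0]; linarith
  have h1 := one_add_half_sub_le_sqrt hx1
  have h2 : √b = r * √(1 + x) := by
    rw [← Real.sqrt_sq hr.le, ← Real.sqrt_mul (sq_nonneg r), hk, hx]
    congr 1; field_simp; ring
  have h3 : x ^ 2 ≤ 10 * L ^ 2 / k := by
    have h4 : (b - (k - j)) ^ 2 ≤ (2 * L * r) ^ 2 := sq_le_sq' (abs_le.1 hbL).1 (abs_le.1 hbL).2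
    have h5 : (b - k) ^ 2 ≤ 10 * L ^ 2 * k := by
      have : (b - k) ^ 2 ≤ 2 * (b - (k - j)) ^ 2 + 2 * j ^ 2 := by
        nlinarith [sq_nonneg (b - (k - j) + j)]
      have : 1 ≤ L ^ 2 := one_le_pow₀ hL
      nlinarith
    rw [hx, div_pow, div_le_div_iff₀ (by positivity) hk0]
    nlinarith
  have h6 : 2 * r + (b - (k - j)) / r - (j / r + 10 * L ^ 2 / r) ≤ 2 * √b := by
    rw [h2]
    have h7 : 2 * r + (b - (k - j)) / r - (j / r + 10 * L ^ 2 / r) =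
        2 * (r * (1 + x / 2 - (10 * L ^ 2 / k) / 2)) := by
      rw [hx, ← hk]; field_simp; ring
    rw [h7]
    have : 1 + x / 2 - (10 * L ^ 2 / k) / 2 ≤ √(1 + x) := by linarith
    gcongr
  have := mul_le_mul_of_nonneg_right h6 hz
  linarith

theorem le_jacobiForm_parabola {k : ℕ} {q L : ℝ} (hq : 1 ≤ q) (hk : q ^ 6 = k) (hL : 1 ≤ L)
    {a b : ℕ → ℝ} (hb : ∀ i, 0 ≤ b i) (hbL : ∀ i < k, |b i - ((k : ℝ) - i - 1)| ≤ 2 * L * q ^ 3)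
    {p : ℕ} (hp : p = ⌊q ^ 2⌋₊)
    (hN : -L ≤ ∑ i ∈ Finset.range k, (parabola p i ^ 2 / (2 * q ^ 9) * a i +
      parabola p i * parabola p (i + 1) / (2 * q ^ 12) * (b i - ((k : ℝ) - i - 1)))) :
    (2 * q ^ 3 - 85 * L ^ 2 / q) * ∑ i ∈ Finset.range k, parabola p i ^ 2 ≤
        jacobiForm k a b (parabola p) ∧
      0 < ∑ i ∈ Finset.range k, parabola p i ^ 2 ∧ p ≤ k := by
  have hq0 : 0 < q := by linarith
  have hq2 : 1 ≤ q ^ 2 := one_le_pow₀ hq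
  have hp1 : (p : ℝ) ≤ q ^ 2 := by rw [hp]; exact Nat.floor_le (by positivity)
  have hp2 : q ^ 2 ≤ (p : ℝ) + 1 := by rw [hp]; exact (Nat.lt_floor_add_one _).le
  have hp3 : 1 ≤ p := by rw [hp]; exact (Nat.one_le_floor_iff _).2 hq2
  have hp3' : (1 : ℝ) ≤ p := by exact_mod_cast hp3
  have hpk : p ≤ k := by
    have : (p : ℝ) ≤ k := by
      rw [← hk]; exact hp1.trans (pow_le_pow_right₀ hq (by norm_num))
    exact_mod_cast this
  have hQ := sum_parabola_sq hpk
  have hC := two_mul_sum_parabola_mul hpk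
  set Q := ∑ i ∈ Finset.range k, parabola p i ^ 2 with hQdef
  set C := ∑ i ∈ Finset.range k, parabola p i * parabola p (i + 1) with hCdef
  set P : ℝ := (p : ℝ) + 1 with hP
  have hP2 : 2 ≤ P := by linarith
  have hP4 : 16 ≤ P ^ 4 := by
    calc (16 : ℝ) = 2 ^ 4 := by norm_num
      _ ≤ P ^ 4 := by gcongr
  have hQ32 : P ^ 5 / 32 ≤ Q := by
    rw [hQ]; nlinarith
  have hQ10 : q ^ 10 / 32 ≤ Q := by
    have : (q ^ 2) ^ 5 ≤ P ^ 5 := by gcongr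
    calc q ^ 10 / 32 = (q ^ 2) ^ 5 / 32 := by ring
      _ ≤ _ := by linarith
  have hQ0 : 0 < Q := lt_of_lt_of_le (by positivity) hQ10
  refine ⟨?_, hQ0, hpk⟩
  have hE : P * (P ^ 2 - 1) / 3 ≤ 10 * Q / q ^ 4 := by
    rw [le_div_iff₀ (by positivity), hQ]
    have h1 : q ^ 4 ≤ P ^ 2 + 1 := by
      have : (q ^ 2) ^ 2 ≤ P ^ 2 := by gcongr
      nlinarith
    have h2 : 0 ≤ P * (P ^ 2 - 1) / 3 := by
      have : 0 ≤ P ^ 2 - 1 := by nlinarith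
      positivity
    calc P * (P ^ 2 - 1) / 3 * q ^ 4 ≤ P * (P ^ 2 - 1) / 3 * (P ^ 2 + 1) := by gcongr
      _ = 10 * ((P ^ 5 - P) / 30) := by ring
  have hCE : 2 * C = 2 * Q - P * (P ^ 2 - 1) / 3 := by rw [hC, hQ]
  have hCQ : C ≤ Q := by
    have : 0 ≤ P * (P ^ 2 - 1) / 3 := by
      have : 0 ≤ P ^ 2 - 1 := by nlinarith
      positivity
    linarith
  have hterm : ∀ i ∈ Finset.range k, 2 * q ^ 3 * (parabola p i * parabola p (i + 1)) +
      (b i - ((k : ℝ) - i - 1)) / q ^ 3 * (parabola p i * parabola p (i + 1)) -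
      (11 * L ^ 2 / q) * (parabola p i * parabola p (i + 1)) ≤
      2 * √(b i) * (parabola p i * parabola p (i + 1)) := by
    intro i hi
    rcases le_or_gt p i with h | h
    · simp [parabola_eq_zero h]
    have hz := mul_nonneg (parabola_nonneg p i) (parabola_nonneg p (i + 1))
    have hi1 : (i : ℝ) + 1 ≤ q ^ 2 := by
      refine le_trans ?_ hp1; exact_mod_cast h
    have hbi := hbL i (Finset.mem_range.1 hi)
    rw [sub_sub] at hbi ⊢
    have h1 := le_two_sqrt_mul (k := k) (j := i + 1) (r := q ^ 3) (by positivity)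
      (by rw [← hk]; ring) hL (hb i) hz
      (by
        rw [← hk]
        calc ((i : ℝ) + 1) ^ 2 ≤ (q ^ 2) ^ 2 := by gcongr
          _ ≤ q ^ 6 := by rw [← pow_mul]; exact pow_le_pow_right₀ hq (by norm_num)) hbi
    have h2 : ((i : ℝ) + 1) / q ^ 3 + 10 * L ^ 2 / q ^ 3 ≤ 11 * L ^ 2 / q := by
      have h3 : ((i : ℝ) + 1) / q ^ 3 ≤ 1 / q := by
        rw [div_le_div_iff₀ (by positivity) hq0]; nlinarith
      have h4 : 10 * L ^ 2 / q ^ 3 ≤ 10 * L ^ 2 / q := by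
        gcongr
        exact le_self_pow₀ hq (by norm_num)
      have h5 : 1 / q ≤ L ^ 2 / q := by
        gcongr
        exact one_le_pow₀ hL
      have : 11 * L ^ 2 / q = 10 * L ^ 2 / q + L ^ 2 / q := by ring
      linarith
    have := mul_le_mul_of_nonneg_right h2 hz
    linarith
  have hsum := Finset.sum_le_sum hterm
  rw [Finset.sum_sub_distrib, Finset.sum_add_distrib, ← Finset.mul_sum, ← Finset.mul_sum] at hsum
  have hN' : -(2 * L * q ^ 9) ≤ ∑ i ∈ Finset.range k, a i * parabola p i ^ 2 +
      ∑ i ∈ Finset.range k,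
        (b i - ((k : ℝ) - i - 1)) / q ^ 3 * (parabola p i * parabola p (i + 1)) := by
    have h1 := mul_le_mul_of_nonneg_left hN (show 0 ≤ 2 * q ^ 9 by positivity)
    rw [Finset.mul_sum] at h1
    rw [← Finset.sum_add_distrib]
    refine le_trans (by linarith) (h1.trans_eq (Finset.sum_congr rfl fun i _ => ?_))
    field_simp
  rw [jacobiForm, Finset.sum_add_distrib]
  have hLq : 2 * L * q ^ 9 ≤ 64 * L ^ 2 / q * Q := by
    have h1 : L ≤ L ^ 2 := le_self_pow₀ hL (by norm_num)
    calc 2 * L * q ^ 9 ≤ 2 * L ^ 2 * q ^ 9 := by gcongr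
      _ = 64 * L ^ 2 / q * (q ^ 10 / 32) := by field_simp; ring
      _ ≤ _ := by gcongr
  have hqE : q ^ 3 * (2 * C) ≥ (2 * q ^ 3 - 10 / q) * Q := by
    rw [hCE]
    have : q ^ 3 * (P * (P ^ 2 - 1) / 3) ≤ q ^ 3 * (10 * Q / q ^ 4) := by gcongr
    have e : q ^ 3 * (10 * Q / q ^ 4) = 10 / q * Q := by field_simp
    linarith
  have h10 : 10 / q * Q ≤ 10 * L ^ 2 / q * Q := by
    have : 1 ≤ L ^ 2 := one_le_pow₀ hL
    gcongr
    linarith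
  have h11 : 11 * L ^ 2 / q * C ≤ 11 * L ^ 2 / q * Q := by gcongr
  have e : 85 * L ^ 2 / q * Q = 10 * L ^ 2 / q * Q + 11 * L ^ 2 / q * Q + 64 * L ^ 2 / q * Q := by
    ring
  linarith

section

open Complex Matrix

lemma integrable_of_integral_pos {α : Type*} {mα : MeasurableSpace α} {μ : Measure α} {f : α → ℝ}
    (h : 0 < ∫ x, f x ∂μ) : Integrable f μ :=
  not_imp_comm.1 integral_undef h.ne'

lemma integral_exp_mul_sq_gaussianReal (u : ℝ) :
    ∫ x, Real.exp (u * x ^ 2) ∂(gaussianReal 0 (1 / 2)) = (√(1 - u))⁻¹ := by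
  rw [integral_gaussianReal_eq_integral_smul (by norm_num)]
  have h : ∀ x : ℝ, gaussianPDFReal 0 (1 / 2) x • Real.exp (u * x ^ 2) =
      (√Real.pi)⁻¹ * Real.exp (-(1 - u) * x ^ 2) := by
    intro x
    rw [gaussianPDFReal, smul_eq_mul, mul_assoc, ← Real.exp_add]
    have e1 : 2 * Real.pi * ((1 / 2 : NNReal) : ℝ) = Real.pi := by push_cast; ring
    rw [e1]
    congr 2
    push_cast
    ring
  simp_rw [h]
  rw [integral_const_mul, integral_gaussian, Real.sqrt_div Real.pi_pos.le, div_eq_mul_inv,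
    ← mul_assoc, inv_mul_cancel₀ (Real.sqrt_pos.2 Real.pi_pos).ne', one_mul]

lemma integral_exp_normSq_complexGaussian {u : ℝ} (hu : u < 1) :
    ∫ z, Real.exp (u * normSq z) ∂complexGaussian = (1 - u)⁻¹ := by
  rw [complexGaussian, integral_map (Measurable.aemeasurable (by fun_prop))
    (Continuous.aestronglyMeasurable (by have := continuous_normSq; fun_prop))]
  have h : ∀ p : ℝ × ℝ, Real.exp (u * normSq ((p.1 : ℂ) + p.2 * I)) =
      Real.exp (u * p.1 ^ 2) * Real.exp (u * p.2 ^ 2) := by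
    intro p
    rw [normSq_add_mul_I, mul_add, Real.exp_add]
  simp_rw [h]
  rw [integral_prod_mul (fun x : ℝ => Real.exp (u * x ^ 2)) fun x : ℝ => Real.exp (u * x ^ 2),
    integral_exp_mul_sq_gaussianReal, ← mul_inv, Real.mul_self_sqrt (by linarith)]

lemma integral_exp_rowLaw (d : ℕ) (s : ℝ) {u : ℝ} (hu : u < 1) :
    ∫ y, Real.exp (s * y.1 + u * (y.2 - d)) ∂(rowLaw d) =
      Real.exp (s ^ 2 / 2) * (Real.exp (-u) * (1 - u)⁻¹) ^ d := by
  rw [rowLaw, integral_map (measurable_rowMap d).aemeasurable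
    (Continuous.aestronglyMeasurable (by fun_prop))]
  have h : ∀ q : ℝ × (Fin d → ℂ), Real.exp (s * q.1 + u * (sqNorm q.2 - d)) =
      Real.exp (s * q.1) * (Real.exp (-u) ^ d * ∏ i, Real.exp (u * normSq (q.2 i))) := by
    intro q
    rw [← Real.exp_sum, ← Real.exp_nat_mul, ← Real.exp_add, ← Real.exp_add, sqNorm, ← Finset.mul_sum]
    congr 1; ring
  simp only [h]
  rw [integral_prod_mul (fun x : ℝ => Real.exp (s * x))
    (fun z : Fin d → ℂ => Real.exp (-u) ^ d * ∏ i, Real.exp (u * normSq (z i))),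
    integral_const_mul, complexGaussianPi,
    integral_fintype_prod_eq_pow (fun z : ℂ => Real.exp (u * normSq z)),
    integral_exp_normSq_complexGaussian hu, Fintype.card_fin, mul_pow]
  congr 1
  have := mgf_gaussianReal (p := gaussianReal 0 1) (X := id) (μ := 0) (v := 1) (by simp) s
  simpa [mgf] using this

lemma exp_neg_mul_inv_one_sub_le {u : ℝ} (hu : |u| ≤ 1 / 2) :
    Real.exp (-u) * (1 - u)⁻¹ ≤ Real.exp (u ^ 2) := by
  obtain ⟨h1, h2⟩ := abs_le.1 hu
  have h3 : 0 < 1 - u := by linarith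
  rw [← div_eq_mul_inv, div_le_iff₀ h3, Real.exp_neg, inv_le_iff_one_le_mul₀ (Real.exp_pos _)]
  suffices h : 1 ≤ Real.exp (u + u ^ 2) * (1 - u) by
    rw [Real.exp_add] at h
    linarith
  rcases le_total 0 u with h | h
  · have h4 := Real.quadratic_le_exp_of_nonneg (show 0 ≤ u + u ^ 2 by positivity)
    refine le_trans ?_ (mul_le_mul_of_nonneg_right h4 h3.le)
    have h5 : 2 * u ≤ (1 - u) * (1 + u) ^ 2 := by nlinarith [mul_nonneg h h]
    nlinarith [mul_le_mul_of_nonneg_left h5 (sq_nonneg u)]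
  · have h4 := Real.add_one_le_exp (u + u ^ 2)
    refine le_trans ?_ (mul_le_mul_of_nonneg_right h4 h3.le)
    nlinarith [mul_nonneg (sq_nonneg u) (neg_nonneg.2 h)]

/-- Chernoff bound for linear statistics of the Jacobi coefficients. -/
theorem jacobiLaw_real_linear_ge_le (k : ℕ) (s u : ℕ → ℝ) (hu : ∀ i < k, |u i| ≤ 1 / 2) (R : ℝ) :
    (jacobiLaw k).real {x | R ≤ ∑ i : Fin k,
      (s i * (x i).1 + u i * ((x i).2 - ((k : ℝ) - i - 1)))} ≤
      Real.exp (∑ i ∈ Finset.range k, (s i ^ 2 / 2 + u i ^ 2 * (k - i)) - R) := by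
  set X : (Fin k → ℝ × ℝ) → ℝ := fun x => ∑ i : Fin k,
      (s i * (x i).1 + u i * ((x i).2 - ((k : ℝ) - i - 1))) with hX
  have hd : ∀ i : Fin k, ((k - ((i : ℕ) + 1) : ℕ) : ℝ) = (k : ℝ) - i - 1 := by
    intro i
    have : (i : ℕ) + 1 ≤ k := i.2
    push_cast [Nat.cast_sub this]
    ring
  have hI : ∫ x, Real.exp (X x) ∂(jacobiLaw k) =
      ∏ i : Fin k, Real.exp (s i ^ 2 / 2) *
        (Real.exp (-u i) * (1 - u i)⁻¹) ^ (k - ((i : ℕ) + 1)) := by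
    simp only [hX, Real.exp_sum, ← hd]
    rw [jacobiLaw, integral_fintype_prod_eq_prod (fun (i : Fin k) (y : ℝ × ℝ) =>
      Real.exp (s i * y.1 + u i * (y.2 - ((k - ((i : ℕ) + 1) : ℕ) : ℝ))))]
    refine Finset.prod_congr rfl fun i _ => ?_
    exact integral_exp_rowLaw _ _ (by linarith [(abs_le.1 (hu i i.2)).2])
  have hpos : ∀ i : Fin k, 0 < Real.exp (-u i) * (1 - u i)⁻¹ := fun i =>
    mul_pos (Real.exp_pos _) (inv_pos.2 (by linarith [(abs_le.1 (hu i i.2)).2]))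
  have hInt : Integrable (fun x => Real.exp (1 * X x)) (jacobiLaw k) := by
    simp only [one_mul]
    apply integrable_of_integral_pos
    rw [hI]
    exact Finset.prod_pos fun i _ => mul_pos (Real.exp_pos _) (pow_pos (hpos i) _)
  have hle : ∫ x, Real.exp (X x) ∂(jacobiLaw k) ≤
      Real.exp (∑ i ∈ Finset.range k, (s i ^ 2 / 2 + u i ^ 2 * (k - i))) := by
    rw [hI, ← Fin.sum_univ_eq_sum_range (fun i => s i ^ 2 / 2 + u i ^ 2 * (k - i)), Real.exp_sum]
    refine Finset.prod_le_prod (fun i _ => (mul_pos (Real.exp_pos _) (pow_pos (hpos i) _)).le)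
      fun i _ => ?_
    rw [Real.exp_add]
    gcongr
    calc _ ≤ Real.exp (u i ^ 2) ^ (k - ((i : ℕ) + 1)) :=
          pow_le_pow_left₀ (hpos i).le (exp_neg_mul_inv_one_sub_le (hu i i.2)) _
      _ = Real.exp (u i ^ 2 * (k - i - 1)) := by rw [← Real.exp_nat_mul, hd, mul_comm]
      _ ≤ Real.exp (u i ^ 2 * (k - i)) := by
        have := sq_nonneg (u i)
        exact Real.exp_le_exp.2 (by linarith)
  have h := measure_ge_le_exp_mul_mgf (μ := jacobiLaw k) (X := X) R zero_le_one hInt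
  refine h.trans ?_
  rw [mgf, sub_eq_add_neg, Real.exp_add, mul_comm]
  simp only [one_mul, neg_mul]
  gcongr

end

/-- The diagonal entries, extended by zero. -/
def diagSeq {k : ℕ} (x : Fin k → ℝ × ℝ) (i : ℕ) : ℝ := if h : i < k then (x ⟨i, h⟩).1 else 0

/-- The squared off-diagonal entries, extended by zero. -/
def offSeq {k : ℕ} (x : Fin k → ℝ × ℝ) (i : ℕ) : ℝ := if h : i < k then (x ⟨i, h⟩).2 else 0

lemma seq_eq {k : ℕ} (x : Fin k → ℝ × ℝ) : (fun i : Fin k => (diagSeq x i, offSeq x i)) = x := by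
  ext i <;> simp [diagSeq, offSeq]

lemma ae_offSeq_nonneg (k : ℕ) : ∀ᵐ x ∂(jacobiLaw k), ∀ i, 0 ≤ offSeq x i := by
  have h : ∀ i : Fin k, ∀ᵐ x ∂(jacobiLaw k), 0 ≤ (x i).2 := by
    intro i
    have h1 : ∀ᵐ y ∂(rowLaw (k - (i + 1))), 0 ≤ y.2 := by
      rw [rowLaw, ae_map_iff (measurable_rowMap _).aemeasurable
        (measurableSet_le measurable_const measurable_snd)]
      exact ae_of_all _ fun q => sqNorm_nonneg _
    exact (Measure.tendsto_eval_ae_ae (μ := fun i : Fin k => rowLaw (k - (i + 1)))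
      (i := i)).eventually h1
  filter_upwards [ae_all_iff.2 h] with x hx i
  unfold offSeq
  split_ifs with hi
  · exact hx ⟨i, hi⟩
  · exact le_rfl

/-- A linear statistic of the Jacobi coefficients. -/
def linStat {k : ℕ} (s u : ℕ → ℝ) (x : Fin k → ℝ × ℝ) : ℝ :=
  ∑ i ∈ Finset.range k, (s i * diagSeq x i + u i * (offSeq x i - ((k : ℝ) - i - 1)))

lemma linStat_eq {k : ℕ} (s u : ℕ → ℝ) (x : Fin k → ℝ × ℝ) :
    linStat s u x = ∑ i : Fin k, (s i * (x i).1 + u i * ((x i).2 - ((k : ℝ) - i - 1))) := by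
  rw [linStat, ← Fin.sum_univ_eq_sum_range
    (fun i => s i * diagSeq x i + u i * (offSeq x i - ((k : ℝ) - i - 1)))]
  simp [diagSeq, offSeq]

lemma linStat_neg {k : ℕ} (s u : ℕ → ℝ) (x : Fin k → ℝ × ℝ) :
    linStat (-s) (-u) x = -linStat s u x := by
  rw [linStat, linStat, ← Finset.sum_neg_distrib]
  exact Finset.sum_congr rfl fun i _ => by simp only [Pi.neg_apply]; ring

lemma jacobiLaw_linStat_ge_le {k : ℕ} {s u : ℕ → ℝ} (hu : ∀ i < k, |u i| ≤ 1 / 2)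
    (hv : ∑ i ∈ Finset.range k, (s i ^ 2 / 2 + u i ^ 2 * (k - i)) ≤ 1) (L : ℝ) :
    (jacobiLaw k).real {x | L ≤ linStat s u x} ≤ Real.exp (1 - L) := by
  simp only [linStat_eq]
  refine (jacobiLaw_real_linear_ge_le k s u hu L).trans ?_
  gcongr

lemma jacobiLaw_abs_linStat_ge_le {k : ℕ} {s u : ℕ → ℝ} (hu : ∀ i < k, |u i| ≤ 1 / 2)
    (hv : ∑ i ∈ Finset.range k, (s i ^ 2 / 2 + u i ^ 2 * (k - i)) ≤ 1) (L : ℝ) :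
    (jacobiLaw k).real {x | L ≤ |linStat s u x|} ≤ 2 * Real.exp (1 - L) := by
  have h1 := jacobiLaw_linStat_ge_le hu hv L
  have h2 := jacobiLaw_linStat_ge_le (s := -s) (u := -u) (k := k) (by simpa using hu)
    (by simpa using hv) L
  simp only [linStat_neg] at h2
  have h3 : {x : Fin k → ℝ × ℝ | L ≤ |linStat s u x|} ⊆
      {x | L ≤ linStat s u x} ∪ {x | L ≤ -linStat s u x} := fun x hx => by
    simpa only [Set.mem_union, Set.mem_ofPred_eq, le_abs] using hx
  have h4 := (measureReal_mono (μ := jacobiLaw k) h3).trans (measureReal_union_le _ _)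
  linarith

/-- The weights of the discounted partial sums. -/
def leakyWeight (θ : ℝ) (m j : ℕ) : ℝ := if j < m then θ ^ (m - 1 - j) else 0

lemma leakyWeight_succ_self (θ : ℝ) (m : ℕ) : leakyWeight θ (m + 1) m = 1 := by
  simp [leakyWeight]

lemma leakyWeight_succ_of_lt (θ : ℝ) {m j : ℕ} (h : j < m) :
    leakyWeight θ (m + 1) j = θ * leakyWeight θ m j := by
  rw [leakyWeight, leakyWeight, if_pos h, if_pos (by omega), ← pow_succ']
  congr 1; omega

lemma leakySum_eq (θ : ℝ) (w : ℕ → ℝ) (m : ℕ) :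
    leakySum θ w m = ∑ j ∈ Finset.range m, leakyWeight θ m j * w j := by
  induction m with
  | zero => simp [leakySum]
  | succ m ih =>
    rw [Finset.sum_range_succ, leakyWeight_succ_self, leakySum, ih, Finset.mul_sum, one_mul]
    congr 1
    refine Finset.sum_congr rfl fun j hj => ?_
    rw [leakyWeight_succ_of_lt θ (Finset.mem_range.1 hj)]
    ring

lemma leakySum_eq_sum_range (θ : ℝ) (w : ℕ → ℝ) {m k : ℕ} (hmk : m ≤ k) :
    leakySum θ w m = ∑ j ∈ Finset.range k, leakyWeight θ m j * w j := by
  rw [leakySum_eq, sum_range_eq_of_support hmk]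
  intro i hi
  rw [leakyWeight, if_neg (by omega), zero_mul]

lemma sum_leakyWeight_sq_le {θ : ℝ} (h0 : 0 ≤ θ) (h1 : θ < 1) {m k : ℕ} (hmk : m ≤ k) :
    ∑ j ∈ Finset.range k, leakyWeight θ m j ^ 2 ≤ 1 / (1 - θ) := by
  rw [sum_range_eq_of_support hmk fun i hi => by simp [leakyWeight, hi]]
  clear hmk
  have h2 : 0 < 1 - θ := by linarith
  induction m with
  | zero => simp [h1.le]
  | succ m ih =>
    rw [Finset.sum_range_succ, leakyWeight_succ_self]
    have : ∑ j ∈ Finset.range m, leakyWeight θ (m + 1) j ^ 2 =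
        θ ^ 2 * ∑ j ∈ Finset.range m, leakyWeight θ m j ^ 2 := by
      rw [Finset.mul_sum]
      refine Finset.sum_congr rfl fun j hj => ?_
      rw [leakyWeight_succ_of_lt θ (Finset.mem_range.1 hj), mul_pow]
    rw [this]
    calc _ ≤ θ ^ 2 * (1 / (1 - θ)) + 1 ^ 2 := by gcongr
      _ ≤ 1 / (1 - θ) := by
        rw [mul_one_div, div_add' _ _ _ h2.ne', div_le_div_iff_of_pos_right h2]
        nlinarith

lemma abs_leakyWeight_le {θ : ℝ} (h0 : 0 ≤ θ) (h1 : θ ≤ 1) (m j : ℕ) :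
    |leakyWeight θ m j| ≤ 1 := by
  rw [leakyWeight]
  split_ifs
  · rw [abs_of_nonneg (by positivity)]; exact pow_le_one₀ h0 h1
  · simp

lemma measureReal_iUnion_fin_le {α : Type*} {mα : MeasurableSpace α} {μ : Measure α}
    [IsProbabilityMeasure μ] {k : ℕ} {E : Fin k → Set α} {c : ℝ} (h : ∀ i, μ.real (E i) ≤ c) :
    μ.real (⋃ i, E i) ≤ k * c := by
  refine (measureReal_iUnion_fintype_le _).trans ?_
  refine (Finset.sum_le_sum fun i _ => h i).trans ?_
  simp

lemma measureReal_le_of_ae_imp {α : Type*} {mα : MeasurableSpace α} {μ : Measure α}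
    [IsProbabilityMeasure μ] {S T : Set α} (h : ∀ᵐ x ∂μ, x ∈ S → x ∈ T) :
    μ.real S ≤ μ.real T :=
  ENNReal.toReal_mono (measure_ne_top _ _) (measure_mono_ae h)

/-- Upper tail of the edge of the Jacobi matrix. -/
theorem jacobiLaw_not_chainSurvives_le {k : ℕ} {q L : ℝ} (hq : 1 ≤ q) (hk : q ^ 6 = k)
    (hL : 1 ≤ L) :
    (jacobiLaw k).real {x | ¬ ChainSurvives (2 * q ^ 3 + 13144 * L ^ 8 / q) k 0 x} ≤
      4 * k * Real.exp (1 - L) := by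
  have hq0 : 0 < q := by linarith
  set θ := 1 - 1 / q ^ 2 with hθ
  have hq2 : 1 / q ^ 2 ≤ 1 := by
    rw [div_le_one (by positivity)]; exact one_le_pow₀ hq
  have hq2' : 0 < 1 / q ^ 2 := by positivity
  have hθ0 : 0 ≤ θ := by linarith
  have hθ1 : θ < 1 := by linarith
  have hinv : 1 / (1 - θ) = q ^ 2 := by rw [hθ]; field_simp; ring
  have hD : ∀ j < k, 1 ≤ (k : ℝ) - j := by
    intro j hj
    have : (j : ℝ) + 1 ≤ k := by exact_mod_cast hj
    linarith
  set E₁ : Fin k → Set (Fin k → ℝ × ℝ) := fun i =>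
    {x | L ≤ |linStat (fun j => leakyWeight θ (i + 1) j / q) 0 x|} with hE₁
  set E₂ : Fin k → Set (Fin k → ℝ × ℝ) := fun i =>
    {x | L ≤ |linStat 0 (fun j => leakyWeight θ (i + 1) j / q / (2 * √((k : ℝ) - j))) x|} with hE₂
  have h1 : ∀ i, (jacobiLaw k).real (E₁ i) ≤ 2 * Real.exp (1 - L) := by
    intro i
    refine jacobiLaw_abs_linStat_ge_le (by simp) ?_ L
    have := sum_leakyWeight_sq_le hθ0 hθ1 (Nat.succ_le_of_lt i.2)
    rw [hinv] at this
    simp only [Pi.zero_apply, ne_eq, OfNat.ofNat_ne_zero, not_false_eq_true, zero_pow, zero_mul,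
      add_zero, div_pow]
    rw [← Finset.sum_div, ← Finset.sum_div, div_div, div_le_one (by positivity)]
    nlinarith [sq_nonneg q]
  have h2 : ∀ i, (jacobiLaw k).real (E₂ i) ≤ 2 * Real.exp (1 - L) := by
    intro i
    refine jacobiLaw_abs_linStat_ge_le ?_ ?_ L
    · intro j hj
      have h3 := abs_leakyWeight_le hθ0 hθ1.le (i + 1) j
      have h4 : 1 ≤ √((k : ℝ) - j) := Real.one_le_sqrt.2 (hD j hj)
      rw [abs_div, abs_div, abs_of_pos hq0, abs_of_pos (show 0 < 2 * √((k : ℝ) - j) by positivity)]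
      have h5 : |leakyWeight θ (i + 1) j| / q ≤ 1 := (div_le_one hq0).2 (h3.trans hq)
      rw [div_le_div_iff₀ (by positivity) (by norm_num)]
      linarith
    · have := sum_leakyWeight_sq_le hθ0 hθ1 (Nat.succ_le_of_lt i.2)
      rw [hinv] at this
      have e : ∀ j ∈ Finset.range k, (0 : ℕ → ℝ) j ^ 2 / 2 +
          (leakyWeight θ (i + 1) j / q / (2 * √((k : ℝ) - j))) ^ 2 * ((k : ℝ) - j) =
          leakyWeight θ (i + 1) j ^ 2 / (4 * q ^ 2) := by
        intro j hj
        have h4 := hD j (Finset.mem_range.1 hj)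
        have h5 := Real.sq_sqrt (show 0 ≤ (k : ℝ) - j by linarith)
        rw [div_pow, mul_pow, h5]
        have : (k : ℝ) - j ≠ 0 := by linarith
        simp only [Pi.zero_apply]
        field_simp
        ring
      rw [Finset.sum_congr rfl e, ← Finset.sum_div, div_le_one (by positivity)]
      nlinarith [sq_nonneg q]
  have hincl : ∀ᵐ x ∂(jacobiLaw k), x ∈ {x : Fin k → ℝ × ℝ |
      ¬ ChainSurvives (2 * q ^ 3 + 13144 * L ^ 8 / q) k 0 x} → x ∈ (⋃ i, E₁ i) ∪ ⋃ i, E₂ i := by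
    filter_upwards [ae_offSeq_nonneg k] with x hx
    contrapose
    intro hxE
    simp only [Set.mem_union, Set.mem_iUnion, not_or, not_exists, hE₁, hE₂, Set.mem_ofPred_eq,
      not_le] at hxE
    obtain ⟨hx1, hx2⟩ := hxE
    rw [← seq_eq x, chainSurvives_iff _ _ _ _ _ hx]
    intro y hy hy0
    have ha : ∀ i < k, |leakySum θ (diagSeq x) (i + 1)| ≤ L * q := by
      intro i hi
      have e : linStat (fun j => leakyWeight θ (i + 1) j / q) 0 x =
          leakySum θ (diagSeq x) (i + 1) / q := by
        rw [leakySum_eq_sum_range θ _ (Nat.succ_le_of_lt hi), Finset.sum_div, linStat]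
        refine Finset.sum_congr rfl fun j _ => ?_
        simp only [Pi.zero_apply]
        ring
      have := (hx1 ⟨i, hi⟩).le
      rwa [e, abs_div, abs_of_pos hq0, div_le_iff₀ hq0] at this
    have hb : ∀ i < k, |leakySum θ
        (fun i => (offSeq x i - ((k : ℝ) - i - 1)) / (2 * √((k : ℝ) - i))) (i + 1)| ≤ L * q := by
      intro i hi
      have e : linStat 0 (fun j => leakyWeight θ (i + 1) j / q / (2 * √((k : ℝ) - j))) x =
          leakySum θ (fun i => (offSeq x i - ((k : ℝ) - i - 1)) / (2 * √((k : ℝ) - i))) (i + 1)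
            / q := by
        rw [leakySum_eq_sum_range θ _ (Nat.succ_le_of_lt hi), Finset.sum_div, linStat]
        refine Finset.sum_congr rfl fun j _ => ?_
        simp only [Pi.zero_apply]
        ring
      have := (hx2 ⟨i, hi⟩).le
      rwa [e, abs_div, abs_of_pos hq0, div_le_iff₀ hq0] at this
    have h3 := jacobiForm_le hq hk hL hx ha hb hy
    have h4 : 0 < ∑ i ∈ Finset.range k, y i ^ 2 := by
      obtain ⟨i, hi⟩ := hy0
      have hik : i < k := by
        by_contra h
        exact hi (hy i (by omega))
      exact Finset.sum_pos' (fun _ _ => sq_nonneg _)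
        ⟨i, Finset.mem_range.2 hik, by positivity⟩
    have h5 : 0 < L ^ 8 / q * ∑ i ∈ Finset.range k, y i ^ 2 := by positivity
    have e : (2 * q ^ 3 + 13144 * L ^ 8 / q) * ∑ i ∈ Finset.range k, y i ^ 2 =
      (2 * q ^ 3 + 13143 * L ^ 8 / q) * ∑ i ∈ Finset.range k, y i ^ 2 +
        L ^ 8 / q * ∑ i ∈ Finset.range k, y i ^ 2 := by ring
    linarith
  refine (measureReal_le_of_ae_imp hincl).trans ((measureReal_union_le _ _).trans ?_)
  have := measureReal_iUnion_fin_le h1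
  have := measureReal_iUnion_fin_le h2
  linarith

/-- Lower tail of the edge of the Jacobi matrix. -/
theorem jacobiLaw_chainSurvives_le {k : ℕ} {q L : ℝ} (hq : 1 ≤ q) (hk : q ^ 6 = k)
    (hL : 1 ≤ L) :
    (jacobiLaw k).real {x | ChainSurvives (2 * q ^ 3 - 85 * L ^ 2 / q) k 0 x} ≤
      (2 * k + 1) * Real.exp (1 - L) := by
  have hq0 : 0 < q := by linarith
  have hk1 : (1 : ℝ) ≤ k := by rw [← hk]; exact one_le_pow₀ hq
  obtain ⟨p, hp⟩ : ∃ p, p = ⌊q ^ 2⌋₊ := ⟨_, rfl⟩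
  have hp1 : (p : ℝ) ≤ q ^ 2 := by rw [hp]; exact Nat.floor_le (by positivity)
  have hy : ∀ i, parabola p i ≤ q ^ 4 := fun i => by
    refine (parabola_le p i).trans ?_
    calc (p : ℝ) ^ 2 ≤ (q ^ 2) ^ 2 := by gcongr
      _ = q ^ 4 := by ring
  set E₁ : Fin k → Set (Fin k → ℝ × ℝ) := fun i =>
    {x | L ≤ |linStat 0 (fun j => if j = i then 1 / (2 * q ^ 3) else 0) x|} with hE₁
  set E₂ : Set (Fin k → ℝ × ℝ) := {x | L ≤ linStat (fun i => -(parabola p i ^ 2 / (2 * q ^ 9)))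
    (fun i => -(parabola p i * parabola p (i + 1) / (2 * q ^ 12))) x} with hE₂
  have h1 : ∀ i, (jacobiLaw k).real (E₁ i) ≤ 2 * Real.exp (1 - L) := by
    intro i
    refine jacobiLaw_abs_linStat_ge_le ?_ ?_ L
    · intro j _
      split_ifs
      · rw [abs_of_pos (by positivity)]
        apply one_div_le_one_div_of_le (by norm_num)
        linarith [one_le_pow₀ (n := 3) hq]
      · simp
    · simp only [Pi.zero_apply, ite_pow, ite_mul]
      simp [Finset.sum_ite_eq']
      have : (0 : ℝ) ≤ (i : ℕ) := by positivity
      have e : ((q ^ 3)⁻¹ * 2⁻¹) ^ 2 * ((k : ℝ) - (i : ℕ)) ≤ ((q ^ 3)⁻¹ * 2⁻¹) ^ 2 * k := by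
        gcongr; linarith
      refine e.trans ?_
      rw [← hk]
      field_simp
      norm_num
  have h2 : (jacobiLaw k).real E₂ ≤ Real.exp (1 - L) := by
    have hyy : ∀ i, 0 ≤ parabola p i * parabola p (i + 1) ∧
        parabola p i * parabola p (i + 1) ≤ q ^ 8 := by
      intro i
      refine ⟨mul_nonneg (parabola_nonneg _ _) (parabola_nonneg _ _), ?_⟩
      calc _ ≤ q ^ 4 * q ^ 4 :=
            mul_le_mul (hy i) (hy (i + 1)) (parabola_nonneg _ _) (by positivity)
        _ = q ^ 8 := by ring
    have hpk : p ≤ k := by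
      have : (p : ℝ) ≤ k := by
        rw [← hk]; exact hp1.trans (pow_le_pow_right₀ hq (by norm_num))
      exact_mod_cast this
    refine jacobiLaw_linStat_ge_le ?_ ?_ L
    · intro i _
      rw [abs_neg, abs_of_nonneg (div_nonneg (hyy i).1 (by positivity)),
        div_le_div_iff₀ (by positivity) (by norm_num)]
      have := (hyy i).2.trans (pow_le_pow_right₀ hq (by norm_num : 8 ≤ 12))
      linarith
    · rw [sum_range_eq_of_support hpk fun i hi => by simp [parabola_eq_zero hi]]
      have hterm : ∀ i ∈ Finset.range p, (-(parabola p i ^ 2 / (2 * q ^ 9))) ^ 2 / 2 +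
          (-(parabola p i * parabola p (i + 1) / (2 * q ^ 12))) ^ 2 * ((k : ℝ) - i) ≤
          1 / q ^ 2 := by
        intro i hi
        have h3 : parabola p i ^ 2 ≤ (q ^ 4) ^ 2 :=
          pow_le_pow_left₀ (parabola_nonneg _ _) (hy i) 2
        have h4 : (k : ℝ) - i ≤ q ^ 6 := by
          rw [hk]; have : (0 : ℝ) ≤ i := by positivity
          linarith
        calc _ = (parabola p i ^ 2 / (2 * q ^ 9)) ^ 2 / 2 +
              (parabola p i * parabola p (i + 1) / (2 * q ^ 12)) ^ 2 * ((k : ℝ) - i) := by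
              rw [neg_sq, neg_sq]
          _ ≤ ((q ^ 4) ^ 2 / (2 * q ^ 9)) ^ 2 / 2 + (q ^ 8 / (2 * q ^ 12)) ^ 2 * q ^ 6 := by
              have hik : (i : ℝ) ≤ k := by
                exact_mod_cast (Finset.mem_range.1 hi).le.trans hpk
              gcongr
              · exact div_nonneg (hyy i).1 (by positivity)
              · exact (hyy i).2
          _ = 3 / 8 * (1 / q ^ 2) := by
              field_simp
              norm_num
          _ ≤ 1 / q ^ 2 := by
              have : 0 ≤ 1 / q ^ 2 := by positivity
              linarith
      refine (Finset.sum_le_sum hterm).trans ?_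
      rw [Finset.sum_const, Finset.card_range, nsmul_eq_mul, mul_one_div,
        div_le_one (by positivity)]
      exact hp1
  have hincl : ∀ᵐ x ∂(jacobiLaw k), x ∈ {x : Fin k → ℝ × ℝ |
      ChainSurvives (2 * q ^ 3 - 85 * L ^ 2 / q) k 0 x} → x ∈ (⋃ i, E₁ i) ∪ E₂ := by
    filter_upwards [ae_offSeq_nonneg k] with x hx
    contrapose
    intro hxE
    simp only [Set.mem_union, Set.mem_iUnion, not_or, not_exists, hE₁, hE₂, Set.mem_ofPred_eq,
      not_le] at hxE
    obtain ⟨hx1, hx2⟩ := hxE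
    rw [← seq_eq x, chainSurvives_iff _ _ _ _ _ hx]
    intro H
    have hb : ∀ i < k, |offSeq x i - ((k : ℝ) - i - 1)| ≤ 2 * L * q ^ 3 := by
      intro i hi
      have e : linStat 0 (fun j => if j = i then 1 / (2 * q ^ 3) else 0) x =
          (offSeq x i - ((k : ℝ) - i - 1)) / (2 * q ^ 3) := by
        simp [linStat, hi]
        ring
      have := (hx1 ⟨i, hi⟩).le
      rw [e, abs_div, abs_of_pos (show 0 < 2 * q ^ 3 by positivity),
        div_le_iff₀ (by positivity)] at this
      linarith
    have hN : -L ≤ ∑ i ∈ Finset.range k, (parabola p i ^ 2 / (2 * q ^ 9) * diagSeq x i +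
        parabola p i * parabola p (i + 1) / (2 * q ^ 12) *
          (offSeq x i - ((k : ℝ) - i - 1))) := by
      have := linStat_neg (fun i => parabola p i ^ 2 / (2 * q ^ 9))
        (fun i => parabola p i * parabola p (i + 1) / (2 * q ^ 12)) x
      change linStat (fun i => -(parabola p i ^ 2 / (2 * q ^ 9)))
        (fun i => -(parabola p i * parabola p (i + 1) / (2 * q ^ 12))) x = _ at this
      rw [this] at hx2
      rw [linStat] at hx2
      linarith
    obtain ⟨h3, h4, h5⟩ := le_jacobiForm_parabola hq hk hL hx hb hp hN
    have h6 : ∃ i, parabola p i ≠ 0 := by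
      by_contra! h
      simp [h] at h4
    have := H (parabola p) (fun i hi => parabola_eq_zero (h5.trans hi)) h6
    linarith
  refine (measureReal_le_of_ae_imp hincl).trans ((measureReal_union_le _ _).trans ?_)
  have := measureReal_iUnion_fin_le h1
  linarith

section

open Complex Matrix

/-- The largest eigenvalue of a Hermitian matrix. -/
def topEig {k : ℕ} (M : Matrix (Fin k) (Fin k) ℂ) : ℝ :=
  if h : 0 < k then eigsDesc M ⟨0, h⟩ else 0

lemma quadForm_diagonal {k : ℕ} (d : Fin k → ℝ) (y : Fin k → ℂ) :
    quadForm (diagonal fun i => (d i : ℂ)) y = ∑ i, d i * normSq (y i) := by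
  simp only [quadForm, dotProduct, mulVec_diagonal, re_sum, Pi.star_apply]
  refine Finset.sum_congr rfl fun i _ => ?_
  simp only [star_def, mul_re, conj_re, conj_im, im_ofReal_mul, ofReal_re, ofReal_im,
    normSq_apply]
  ring

lemma exists_quadForm_eq_sum {k : ℕ} {M : Matrix (Fin k) (Fin k) ℂ} (hM : M.IsHermitian)
    (x : Fin k → ℂ) : ∃ y : Fin k → ℂ, sqNorm y = sqNorm x ∧
      quadForm M x = ∑ i, hM.eigenvalues i * normSq (y i) := by
  set U : Matrix (Fin k) (Fin k) ℂ := hM.eigenvectorUnitary.1 with hU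
  have hUU : (Uᴴ)ᴴ * Uᴴ = 1 := by
    rw [conjTranspose_conjTranspose]
    exact Unitary.mul_star_self_of_mem hM.eigenvectorUnitary.2
  refine ⟨Uᴴ *ᵥ x, sqNorm_mulVec hUU x, ?_⟩
  rw [← quadForm_diagonal, ← quadForm_conj, conjTranspose_conjTranspose]
  congr 1
  exact hM.spectral_theorem

lemma exists_quadForm_eq_eigenvalue {k : ℕ} {M : Matrix (Fin k) (Fin k) ℂ} (hM : M.IsHermitian)
    (j : Fin k) : ∃ v : Fin k → ℂ, v ≠ 0 ∧ quadForm M v = hM.eigenvalues j * sqNorm v := by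
  refine ⟨hM.eigenvectorBasis j, ?_, ?_⟩
  · intro h
    exact hM.eigenvectorBasis.toBasis.ne_zero j (by ext i; simpa using congrFun h i)
  · rw [quadForm, hM.mulVec_eigenvectorBasis, dotProduct_smul, sqNorm_eq_re, Complex.smul_re,
      smul_eq_mul]

lemma eigsDesc_lt_iff {k : ℕ} {M : Matrix (Fin k) (Fin k) ℂ} (hM : M.IsHermitian) {i : Fin k}
    (hi : (i : ℕ) = 0) (s : ℝ) : eigsDesc M i < s ↔ FormLT s M 0 := by
  have hmax : ∀ j, hM.eigenvalues j ≤ eigsDesc M i := by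
    intro j
    rw [eigsDesc, dif_pos hM]
    have := Tuple.monotone_sort hM.eigenvalues
      (show (Tuple.sort hM.eigenvalues).symm j ≤ i.rev by
        rw [Fin.le_def, Fin.val_rev, hi]; omega)
    simpa using this
  have hmem : ∃ j, eigsDesc M i = hM.eigenvalues j := by
    rw [eigsDesc, dif_pos hM]; exact ⟨_, rfl⟩
  constructor
  · intro h x hx
    obtain ⟨y, hy1, hy2⟩ := exists_quadForm_eq_sum hM x
    have h0 := sqNorm_pos hx
    have h1 : quadForm M x ≤ eigsDesc M i * sqNorm x := by
      rw [hy2, ← hy1, sqNorm, Finset.mul_sum]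
      exact Finset.sum_le_sum fun j _ => mul_le_mul_of_nonneg_right (hmax j) (normSq_nonneg _)
    have h2 := mul_lt_mul_of_pos_right h h0
    simp
    linarith
  · intro h
    obtain ⟨j, hj⟩ := hmem
    obtain ⟨v, hv, hv'⟩ := exists_quadForm_eq_eigenvalue hM j
    have h1 := h v hv
    simp only [star_zero, zero_dotProduct, map_zero, add_zero, hv', ← hj] at h1
    exact lt_of_mul_lt_mul_right h1 (sqNorm_nonneg v)

lemma lt_eigsDesc_iff {k : ℕ} {M : Matrix (Fin k) (Fin k) ℂ} (hM : M.IsHermitian) {i : Fin k}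
    (hi : (i : ℕ) + 1 = k) (s : ℝ) : s < eigsDesc M i ↔ FormLT (-s) (-M) 0 := by
  have hmin : ∀ j, eigsDesc M i ≤ hM.eigenvalues j := by
    intro j
    rw [eigsDesc, dif_pos hM]
    have := Tuple.monotone_sort hM.eigenvalues
      (show i.rev ≤ (Tuple.sort hM.eigenvalues).symm j by
        rw [Fin.le_def, Fin.val_rev, hi]; omega)
    simpa using this
  have hmem : ∃ j, eigsDesc M i = hM.eigenvalues j := by
    rw [eigsDesc, dif_pos hM]; exact ⟨_, rfl⟩
  have hneg : ∀ x, quadForm (-M) x = -quadForm M x := fun x => by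
    simp [quadForm, neg_mulVec]
  constructor
  · intro h x hx
    obtain ⟨y, hy1, hy2⟩ := exists_quadForm_eq_sum hM x
    have h0 := sqNorm_pos hx
    have h1 : eigsDesc M i * sqNorm x ≤ quadForm M x := by
      rw [hy2, ← hy1, sqNorm, Finset.mul_sum]
      exact Finset.sum_le_sum fun j _ => mul_le_mul_of_nonneg_right (hmin j) (normSq_nonneg _)
    have h2 := mul_lt_mul_of_pos_right h h0
    simp [hneg]
    linarith
  · intro h
    obtain ⟨j, hj⟩ := hmem
    obtain ⟨v, hv, hv'⟩ := exists_quadForm_eq_eigenvalue hM j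
    have h1 := h v hv
    simp only [star_zero, zero_dotProduct, map_zero, add_zero, hneg, hv', ← hj] at h1
    exact lt_of_mul_lt_mul_right (by linarith : s * sqNorm v < _) (sqNorm_nonneg v)

lemma topEig_lt_iff {k : ℕ} (hk : 0 < k) {M : Matrix (Fin k) (Fin k) ℂ} (hM : M.IsHermitian)
    (s : ℝ) : topEig M < s ↔ FormLT s M 0 := by
  rw [topEig, dif_pos hk, eigsDesc_lt_iff hM rfl]

lemma eigsDesc_last {k : ℕ} (M : Matrix (Fin k) (Fin k) ℂ) {i : Fin k} (hi : (i : ℕ) + 1 = k) :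
    eigsDesc M i = -topEig (-M) := by
  have hk : 0 < k := by omega
  by_cases hM : M.IsHermitian
  · refine eq_of_forall_lt_iff fun s => ?_
    rw [lt_eigsDesc_iff hM hi, ← topEig_lt_iff hk hM.neg, lt_neg]
  · have hM' : ¬ (-M).IsHermitian := fun h => hM (by simpa using h.neg)
    rw [topEig, dif_pos hk, eigsDesc, eigsDesc, dif_neg hM, dif_neg hM']
    simp

lemma topEig_of_not_isHermitian {k : ℕ} {M : Matrix (Fin k) (Fin k) ℂ} (hM : ¬ M.IsHermitian) :
    topEig M = 0 := by
  rw [topEig, eigsDesc, dif_neg hM]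
  simp

lemma measurableSet_isHermitian (k : ℕ) :
    MeasurableSet {M : Matrix (Fin k) (Fin k) ℂ | M.IsHermitian} := by
  have : {M : Matrix (Fin k) (Fin k) ℂ | M.IsHermitian} =
      ⋂ i, ⋂ j, {M | star (M j i) = M i j} := by
    ext M
    simp [Matrix.IsHermitian.ext_iff]
  rw [this]
  refine MeasurableSet.iInter fun i => MeasurableSet.iInter fun j => ?_
  exact measurableSet_eq_fun (Complex.continuous_conj.measurable.comp (measurable_entry j i))
    (measurable_entry i j)

lemma ae_isHermitian (k : ℕ) : ∀ᵐ M ∂(gueMeasure k), M.IsHermitian := by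
  rw [gueMeasure_eq, ae_map_iff (measurable_gueParam k).aemeasurable (measurableSet_isHermitian k)]
  refine ae_of_all _ fun ω => Matrix.IsHermitian.ext fun i j => ?_
  simp only [gueParam, of_apply]
  rcases lt_trichotomy i j with h | h | h
  · rw [if_neg h.ne', if_neg h.le.not_gt, if_neg h.ne, if_pos h]; simp
  · subst h; simp
  · rw [if_neg h.ne, if_pos h, if_neg h.ne', if_neg h.le.not_gt]; simp [sub_eq_add_neg]

lemma measurable_topEig (k : ℕ) :
    Measurable (topEig : Matrix (Fin k) (Fin k) ℂ → ℝ) := by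
  rcases Nat.eq_zero_or_pos k with hk | hk
  · subst hk
    exact measurable_const (a := (0 : ℝ))
  refine measurable_of_Iio fun s => ?_
  have : topEig ⁻¹' Set.Iio s = ({M : Matrix (Fin k) (Fin k) ℂ | M.IsHermitian} ∩
      {M | FormLT s M 0}) ∪ ({M : Matrix (Fin k) (Fin k) ℂ | M.IsHermitian}ᶜ ∩
        {_M | 0 < s}) := by
    ext M
    by_cases hM : M.IsHermitian
    · simp [hM, topEig_lt_iff hk hM]
    · simp [hM, topEig_of_not_isHermitian hM]
  rw [this]
  exact ((measurableSet_isHermitian k).inter (measurableSet_formLT s 0)).union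
    ((measurableSet_isHermitian k).compl.inter (MeasurableSet.const _))

/-- Tail bound for the largest eigenvalue of a GUE matrix. -/
theorem gueMeasure_topEig_le {k : ℕ} {q L : ℝ} (hq : 1 ≤ q) (hk : q ^ 6 = k) (hL : 1 ≤ L) :
    (gueMeasure k).real {M | 13144 * L ^ 8 / q < |topEig M - 2 * q ^ 3|} ≤
      (6 * k + 1) * Real.exp (1 - L) := by
  have hq0 : 0 < q := by linarith
  have hk0 : 0 < k := by
    have : (0 : ℝ) < k := by rw [← hk]; positivity
    exact_mod_cast this
  have hs0 : sqNorm (0 : Fin k → ℂ) = 0 := by simp [sqNorm]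
  have h1 : (gueMeasure k).real {M | ¬ FormLT (2 * q ^ 3 + 13144 * L ^ 8 / q) M 0} ≤
      4 * k * Real.exp (1 - L) := by
    refine le_trans (le_of_eq ?_) (jacobiLaw_not_chainSurvives_le hq hk hL)
    have e1 : {M : Matrix (Fin k) (Fin k) ℂ | ¬ FormLT (2 * q ^ 3 + 13144 * L ^ 8 / q) M 0} =
        {M | FormLT (2 * q ^ 3 + 13144 * L ^ 8 / q) M 0}ᶜ := rfl
    have e2 : {x | ¬ ChainSurvives (2 * q ^ 3 + 13144 * L ^ 8 / q) k 0 x} =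
        {x | ChainSurvives (2 * q ^ 3 + 13144 * L ^ 8 / q) k 0 x}ᶜ := rfl
    have hms : MeasurableSet {x | ChainSurvives (2 * q ^ 3 + 13144 * L ^ 8 / q) k 0 x} :=
      (measurableSet_chainSurvives (2 * q ^ 3 + 13144 * L ^ 8 / q) k).preimage
        (measurable_prodMk_left (x := (0 : ℝ)))
    rw [e1, e2, probReal_compl_eq_one_sub (measurableSet_formLT _ _),
      probReal_compl_eq_one_sub hms, measureReal_def, gueMeasure_formLT, hs0, measureReal_def]
  have h2 : (gueMeasure k).real {M | FormLT (2 * q ^ 3 - 85 * L ^ 2 / q) M 0} ≤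
      (2 * k + 1) * Real.exp (1 - L) := by
    refine le_trans (le_of_eq ?_) (jacobiLaw_chainSurvives_le hq hk hL)
    rw [measureReal_def, gueMeasure_formLT, hs0, measureReal_def]
  have h3 : ∀ᵐ M ∂(gueMeasure k),
      M ∈ {M : Matrix (Fin k) (Fin k) ℂ | 13144 * L ^ 8 / q < |topEig M - 2 * q ^ 3|} →
      M ∈ {M | ¬ FormLT (2 * q ^ 3 + 13144 * L ^ 8 / q) M 0} ∪
        {M | FormLT (2 * q ^ 3 - 85 * L ^ 2 / q) M 0} := by
    filter_upwards [ae_isHermitian k] with M hM h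
    simp only [Set.mem_union, Set.mem_ofPred_eq, ← topEig_lt_iff hk0 hM] at h ⊢
    have h4 : 85 * L ^ 2 / q ≤ 13144 * L ^ 8 / q := by
      have : L ^ 2 ≤ L ^ 8 := pow_le_pow_right₀ hL (by norm_num)
      have : 0 ≤ L ^ 8 := by positivity
      gcongr
      linarith
    rcases lt_abs.1 h with h | h
    · left; linarith
    · right; linarith
  refine (measureReal_le_of_ae_imp h3).trans ((measureReal_union_le _ _).trans ?_)
  linarith

lemma abs_quadForm_le {k : ℕ} (M : Matrix (Fin k) (Fin k) ℂ) (v : Fin k → ℂ) :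
    |quadForm M v| ≤ (∑ i, ∑ j, ‖M i j‖) * sqNorm v := by
  have hle : ∀ i, ‖v i‖ ^ 2 ≤ sqNorm v := fun i => by
    rw [sqNorm, ← normSq_eq_norm_sq]
    exact Finset.single_le_sum (f := fun i => normSq (v i)) (fun j _ => normSq_nonneg _)
      (Finset.mem_univ i)
  refine (Complex.abs_re_le_norm _).trans ?_
  simp only [dotProduct, mulVec, Finset.sum_mul, Finset.mul_sum]
  refine (norm_sum_le _ _).trans (Finset.sum_le_sum fun i _ => (norm_sum_le _ _).trans
    (Finset.sum_le_sum fun j _ => ?_))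
  rw [Pi.star_apply, norm_mul, norm_mul, norm_star]
  have h1 : ‖v i‖ * ‖v j‖ ≤ sqNorm v := by
    nlinarith [hle i, hle j, sq_nonneg (‖v i‖ - ‖v j‖)]
  nlinarith [mul_le_mul_of_nonneg_left h1 (norm_nonneg (M i j))]

lemma abs_topEig_le {k : ℕ} (M : Matrix (Fin k) (Fin k) ℂ) :
    |topEig M| ≤ ∑ i, ∑ j, ‖M i j‖ := by
  have h0 : 0 ≤ ∑ i, ∑ j, ‖M i j‖ :=
    Finset.sum_nonneg fun i _ => Finset.sum_nonneg fun j _ => norm_nonneg _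
  by_cases hM : M.IsHermitian
  · by_cases hk : 0 < k
    · rw [topEig, dif_pos hk, eigsDesc, dif_pos hM]
      obtain ⟨v, hv, hv'⟩ := exists_quadForm_eq_eigenvalue hM
        (Tuple.sort hM.eigenvalues (Fin.rev ⟨0, hk⟩))
      have h := abs_quadForm_le M v
      rw [hv', abs_mul, abs_of_nonneg (sqNorm_nonneg v)] at h
      exact le_of_mul_le_mul_right h (sqNorm_pos hv)
    · rw [topEig, dif_neg hk, abs_zero]
      exact h0
  · rw [topEig_of_not_isHermitian hM, abs_zero]
    exact h0

/-- The sum of the squares of the independent real coordinates. -/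
def coordSq {k : ℕ} (ω : (Fin k → ℝ) × (Fin k × Fin k → ℝ × ℝ)) : ℝ :=
  ∑ i, ω.1 i ^ 2 + ∑ p, ((ω.2 p).1 ^ 2 + (ω.2 p).2 ^ 2)

lemma norm_gueParam_sq_le {k : ℕ} (ω : (Fin k → ℝ) × (Fin k × Fin k → ℝ × ℝ)) (i j : Fin k) :
    ‖gueParam k ω i j‖ ^ 2 ≤ coordSq ω := by
  have h1 : ∀ i, ω.1 i ^ 2 ≤ ∑ i, ω.1 i ^ 2 := fun i =>
    Finset.single_le_sum (f := fun i => ω.1 i ^ 2) (fun j _ => sq_nonneg _) (Finset.mem_univ i)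
  have h2 : ∀ p, (ω.2 p).1 ^ 2 + (ω.2 p).2 ^ 2 ≤ ∑ p, ((ω.2 p).1 ^ 2 + (ω.2 p).2 ^ 2) := fun p =>
    Finset.single_le_sum (f := fun p => (ω.2 p).1 ^ 2 + (ω.2 p).2 ^ 2) (fun j _ => by positivity)
      (Finset.mem_univ p)
  have h3 : 0 ≤ ∑ i, ω.1 i ^ 2 := Finset.sum_nonneg fun i _ => sq_nonneg _
  have h4 : 0 ≤ ∑ p, ((ω.2 p).1 ^ 2 + (ω.2 p).2 ^ 2) := Finset.sum_nonneg fun i _ => by positivity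
  rw [← normSq_eq_norm_sq, normSq_apply, gueParam, coordSq, of_apply]
  split_ifs with hij hlt
  · simp only [ofReal_re, ofReal_im]
    linarith [h1 i]
  · simp
    linarith [h2 (i, j)]
  · simp
    linarith [h2 (j, i)]

lemma topEig_gueParam_sq_le {k : ℕ} (ω : (Fin k → ℝ) × (Fin k × Fin k → ℝ × ℝ)) :
    topEig (gueParam k ω) ^ 2 ≤ k ^ 4 * coordSq ω := by
  have h0 : 0 ≤ coordSq ω := by unfold coordSq; positivity
  have h1 : |topEig (gueParam k ω)| ≤ k ^ 2 * √(coordSq ω) := by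
    refine (abs_topEig_le _).trans ?_
    refine (Finset.sum_le_sum fun i _ => Finset.sum_le_sum fun j _ =>
      Real.le_sqrt_of_sq_le (norm_gueParam_sq_le ω i j)).trans (le_of_eq ?_)
    simp
    ring
  calc topEig (gueParam k ω) ^ 2 = |topEig (gueParam k ω)| ^ 2 := (sq_abs _).symm
    _ ≤ (k ^ 2 * √(coordSq ω)) ^ 2 := by gcongr
    _ = k ^ 4 * coordSq ω := by rw [mul_pow, Real.sq_sqrt h0]; ring

lemma integrable_sq_gaussianReal (v : NNReal) :
    Integrable (fun x : ℝ => x ^ 2) (gaussianReal 0 v) :=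
  (memLp_id_gaussianReal 2).integrable_sq

lemma integral_sq_gaussianReal (v : NNReal) : ∫ x, x ^ 2 ∂(gaussianReal 0 v) = v := by
  have h := variance_id_gaussianReal (μ := 0) (v := v)
  rw [variance_eq_sub (memLp_id_gaussianReal 2)] at h
  simpa using h

lemma integrable_coordSq (k : ℕ) : Integrable (coordSq (k := k)) (gueCoord k) := by
  refine Integrable.add (integrable_finsetSum _ fun i _ => ?_) (integrable_finsetSum _ fun p _ => ?_)
  · have := (integrable_comp_eval (μ := fun _ : Fin k => gaussianReal 0 1) (i := i)
      (integrable_sq_gaussianReal 1))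
    exact this.comp_fst _
  · have h2 : Integrable (fun y : ℝ × ℝ => y.1 ^ 2 + y.2 ^ 2)
        ((gaussianReal 0 (1 / 2)).prod (gaussianReal 0 (1 / 2))) :=
      ((integrable_sq_gaussianReal _).comp_fst _).add ((integrable_sq_gaussianReal _).comp_snd _)
    have := (integrable_comp_eval (μ := fun _ : Fin k × Fin k =>
      (gaussianReal 0 (1 / 2)).prod (gaussianReal 0 (1 / 2))) (i := p) h2)
    exact this.comp_snd _

lemma integral_coordSq (k : ℕ) : ∫ ω, coordSq (k := k) ω ∂(gueCoord k) = k + k ^ 2 := by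
  have h2 : Integrable (fun y : ℝ × ℝ => y.1 ^ 2 + y.2 ^ 2)
      ((gaussianReal 0 (1 / 2)).prod (gaussianReal 0 (1 / 2))) :=
    ((integrable_sq_gaussianReal _).comp_fst _).add ((integrable_sq_gaussianReal _).comp_snd _)
  have i1 : ∀ i : Fin k, Integrable (fun x : Fin k → ℝ => x i ^ 2)
      (Measure.pi fun _ : Fin k => gaussianReal 0 1) := fun i =>
    integrable_comp_eval (μ := fun _ : Fin k => gaussianReal 0 1) (i := i)
      (integrable_sq_gaussianReal 1)
  have i2 : ∀ p : Fin k × Fin k,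
      Integrable (fun x : Fin k × Fin k → ℝ × ℝ => (x p).1 ^ 2 + (x p).2 ^ 2)
      (Measure.pi fun _ : Fin k × Fin k => (gaussianReal 0 (1 / 2)).prod (gaussianReal 0 (1 / 2))) :=
    fun p => integrable_comp_eval (μ := fun _ : Fin k × Fin k =>
      (gaussianReal 0 (1 / 2)).prod (gaussianReal 0 (1 / 2))) (i := p) h2
  have e1 : ∀ i : Fin k, ∫ x : Fin k → ℝ, x i ^ 2
      ∂(Measure.pi fun _ : Fin k => gaussianReal 0 1) = 1 := fun i => by
    rw [integral_comp_eval (μ := fun _ : Fin k => gaussianReal 0 1) (i := i)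
      (f := fun x : ℝ => x ^ 2) (integrable_sq_gaussianReal 1).aestronglyMeasurable,
      integral_sq_gaussianReal]
    simp
  have e2 : ∀ p : Fin k × Fin k,
      ∫ x : Fin k × Fin k → ℝ × ℝ, ((x p).1 ^ 2 + (x p).2 ^ 2)
      ∂(Measure.pi fun _ : Fin k × Fin k =>
        (gaussianReal 0 (1 / 2)).prod (gaussianReal 0 (1 / 2))) = 1 := fun p => by
    rw [integral_comp_eval (μ := fun _ : Fin k × Fin k =>
      (gaussianReal 0 (1 / 2)).prod (gaussianReal 0 (1 / 2))) (i := p)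
      (f := fun y : ℝ × ℝ => y.1 ^ 2 + y.2 ^ 2) h2.aestronglyMeasurable,
      integral_add ((integrable_sq_gaussianReal _).comp_fst _)
        ((integrable_sq_gaussianReal _).comp_snd _),
      integral_fun_fst (fun x : ℝ => x ^ 2), integral_fun_snd (fun x : ℝ => x ^ 2),
      integral_sq_gaussianReal]
    norm_num
  have j1 : Integrable (fun x : Fin k → ℝ => ∑ i, x i ^ 2)
      (Measure.pi fun _ : Fin k => gaussianReal 0 1) := integrable_finsetSum _ fun i _ => i1 i
  have j2 : Integrable (fun x : Fin k × Fin k → ℝ × ℝ => ∑ p, ((x p).1 ^ 2 + (x p).2 ^ 2))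
      (Measure.pi fun _ : Fin k × Fin k => (gaussianReal 0 (1 / 2)).prod (gaussianReal 0 (1 / 2))) :=
    integrable_finsetSum _ fun p _ => i2 p
  simp only [coordSq, gueCoord]
  rw [integral_add (j1.comp_fst _) (j2.comp_snd _),
    integral_fun_fst (fun x : Fin k → ℝ => ∑ i, x i ^ 2),
    integral_fun_snd (fun x : Fin k × Fin k → ℝ × ℝ => ∑ p, ((x p).1 ^ 2 + (x p).2 ^ 2)),
    integral_finsetSum _ fun i _ => i1 i, integral_finsetSum _ fun p _ => i2 p,
    Finset.sum_congr rfl fun i _ => e1 i, Finset.sum_congr rfl fun p _ => e2 p]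
  simp
  ring

lemma integrable_topEig_sq (k : ℕ) :
    Integrable (fun M : Matrix (Fin k) (Fin k) ℂ => topEig M ^ 2) (gueMeasure k) := by
  have hm : Measurable fun M : Matrix (Fin k) (Fin k) ℂ => topEig M ^ 2 :=
    (measurable_topEig k).pow_const 2
  rw [gueMeasure_eq, integrable_map_measure hm.aestronglyMeasurable
    (measurable_gueParam k).aemeasurable]
  refine ((integrable_coordSq k).const_mul ((k : ℝ) ^ 4)).mono'
    (hm.comp (measurable_gueParam k)).aestronglyMeasurable (ae_of_all _ fun ω => ?_)
  rw [Function.comp_apply, Real.norm_of_nonneg (sq_nonneg _)]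
  exact topEig_gueParam_sq_le ω

lemma integral_topEig_sq_le (k : ℕ) : ∫ M, topEig M ^ 2 ∂(gueMeasure k) ≤ k ^ 4 * (k + k ^ 2) := by
  have hm : Measurable fun M : Matrix (Fin k) (Fin k) ℂ => topEig M ^ 2 :=
    (measurable_topEig k).pow_const 2
  have hi := integrable_topEig_sq k
  rw [gueMeasure_eq, integrable_map_measure hm.aestronglyMeasurable
    (measurable_gueParam k).aemeasurable] at hi
  rw [gueMeasure_eq, integral_map (measurable_gueParam k).aemeasurable hm.aestronglyMeasurable,
    ← integral_coordSq, ← integral_const_mul]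
  exact integral_mono hi ((integrable_coordSq k).const_mul _) topEig_gueParam_sq_le

lemma abs_integral_sub_le {α : Type*} [MeasurableSpace α] {μ : Measure α} [IsProbabilityMeasure μ]
    {f : α → ℝ} (hf : Measurable f) (hf2 : Integrable (fun x => f x ^ 2) μ) {m B δ : ℝ}
    (hB : 0 ≤ B) (hδ : 0 < δ) :
    |∫ x, f x ∂μ - m| ≤ B + δ * (∫ x, f x ^ 2 ∂μ + m ^ 2) +
      μ.real {x | B < |f x - m|} / (2 * δ) := by
  have hfi : Integrable f μ := ((memLp_two_iff_integrable_sq hf.aestronglyMeasurable).2 hf2).integrable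
    (by norm_num)
  have hs : MeasurableSet {x | B < |f x - m|} :=
    measurableSet_lt measurable_const (by fun_prop)
  have hbound : ∀ x, |f x - m| ≤ B + δ * (f x ^ 2 + m ^ 2) +
      {x | B < |f x - m|}.indicator (fun _ => 1 / (2 * δ)) x := by
    intro x
    have h0 : 0 ≤ δ * (f x ^ 2 + m ^ 2) := by positivity
    by_cases hx : B < |f x - m|
    · rw [Set.indicator_of_mem (by exact hx)]
      have h1 : |f x - m| ≤ δ / 2 * (f x - m) ^ 2 + 1 / (2 * δ) := by
        rw [← sq_abs (f x - m)]
        have h2 : δ / 2 * |f x - m| ^ 2 + 1 / (2 * δ) - |f x - m| =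
            (δ * |f x - m| - 1) ^ 2 / (2 * δ) := by field_simp; ring
        have h3 : 0 ≤ (δ * |f x - m| - 1) ^ 2 / (2 * δ) := by positivity
        linarith
      have h2 : δ / 2 * (f x - m) ^ 2 ≤ δ * (f x ^ 2 + m ^ 2) := by
        nlinarith [mul_nonneg hδ.le (sq_nonneg (f x + m))]
      linarith
    · rw [Set.indicator_of_notMem (by exact hx)]
      linarith
  have i1 : Integrable (fun x => δ * (f x ^ 2 + m ^ 2)) μ :=
    (hf2.add (integrable_const _)).const_mul δ
  have i2 : Integrable ({x | B < |f x - m|}.indicator (fun _ => 1 / (2 * δ))) μ :=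
    (integrable_const _).indicator hs
  have i3 : Integrable (fun x => B + δ * (f x ^ 2 + m ^ 2)) μ := (integrable_const _).add i1
  calc |∫ x, f x ∂μ - m| = |∫ x, (f x - m) ∂μ| := by
        rw [integral_sub hfi (integrable_const _)]; simp
    _ ≤ ∫ x, |f x - m| ∂μ := abs_integral_le_integral_abs
    _ ≤ ∫ x, (B + δ * (f x ^ 2 + m ^ 2) +
          {x | B < |f x - m|}.indicator (fun _ => 1 / (2 * δ)) x) ∂μ :=
        integral_mono (hfi.sub (integrable_const _)).abs (i3.add i2) hbound
    _ = _ := by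
        rw [integral_add i3 i2, integral_add (integrable_const _) i1, integral_const_mul,
          integral_add hf2 (integrable_const _), integral_indicator_const _ hs]
        simp
        ring

/-- Concentration of the largest eigenvalue of a GUE matrix around its mean. -/
theorem gueMeasure_topEig_sub_integral_le {n k : ℕ} (hn : 2 ≤ n) (hk : 1 ≤ k) (hkn : k ≤ n) {q : ℝ}
    (hq : 1 ≤ q) (hqk : q ^ 6 = k) :
    (gueMeasure k).real {M | 39432 * (110 * Real.log n) ^ 8 / q <
      |topEig M - ∫ M', topEig M' ∂(gueMeasure k)|} ≤ ((n : ℝ) ^ 102)⁻¹ := by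
  have hn' : (2 : ℝ) ≤ n := by exact_mod_cast hn
  have hkn' : (k : ℝ) ≤ n := by exact_mod_cast hkn
  have hk' : (1 : ℝ) ≤ k := by exact_mod_cast hk
  have hn0 : (0 : ℝ) < n := by linarith
  have hq0 : 0 < q := by linarith
  set L : ℝ := 110 * Real.log n with hLdef
  have hL : 1 ≤ L := by
    have h1 := Real.log_two_gt_d9
    have h2 : Real.log 2 ≤ Real.log n := Real.log_le_log (by norm_num) hn'
    rw [hLdef]; linarith
  have hexp : Real.exp (1 - L) ≤ 3 * ((n : ℝ) ^ 110)⁻¹ := by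
    rw [Real.exp_sub, div_eq_mul_inv, hLdef]
    have : Real.exp (110 * Real.log n) = (n : ℝ) ^ 110 := by
      have := Real.exp_nat_mul (Real.log n) 110
      rw [Real.exp_log hn0] at this
      exact_mod_cast this
    rw [this]
    have := Real.exp_one_lt_d9
    gcongr
    linarith
  have hp : (6 * k + 1) * Real.exp (1 - L) ≤ ((n : ℝ) ^ 104)⁻¹ := by
    have h21 : (21 : ℝ) ≤ n ^ 5 := by
      calc (21 : ℝ) ≤ 2 ^ 5 := by norm_num
        _ ≤ n ^ 5 := by gcongr
    calc (6 * k + 1) * Real.exp (1 - L) ≤ (7 * n) * (3 * ((n : ℝ) ^ 110)⁻¹) := by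
          gcongr; linarith
      _ = 21 * (n * ((n : ℝ) ^ 110)⁻¹) := by ring
      _ ≤ n ^ 5 * (n * ((n : ℝ) ^ 110)⁻¹) := by gcongr
      _ = ((n : ℝ) ^ 104)⁻¹ := by field_simp
  have htail := (gueMeasure_topEig_le hq hqk hL).trans hp
  have hB : 13144 * L ^ 8 / q ≥ 13144 / n := by
    have h1 : q ≤ n := by
      calc q ≤ q ^ 6 := le_self_pow₀ hq (by norm_num)
        _ ≤ n := by rw [hqk]; exact hkn'
    have h2 : 1 ≤ L ^ 8 := one_le_pow₀ hL
    apply div_le_div₀ <;> first | positivity | linarith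
  have hmean : |∫ M', topEig M' ∂(gueMeasure k) - 2 * q ^ 3| ≤ 2 * (13144 * L ^ 8 / q) := by
    have h := abs_integral_sub_le (measurable_topEig k) (integrable_topEig_sq k) (m := 2 * q ^ 3)
      (B := 13144 * L ^ 8 / q) (δ := ((n : ℝ) ^ 7)⁻¹) (by positivity) (by positivity)
    have h1 : ∫ M, topEig M ^ 2 ∂(gueMeasure k) + (2 * q ^ 3) ^ 2 ≤ 6 * n ^ 6 := by
      have e : (2 * q ^ 3) ^ 2 = 4 * (k : ℝ) := by rw [← hqk]; ring
      have h2 := integral_topEig_sq_le k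
      have h3 : (k : ℝ) ^ 4 * (k + k ^ 2) ≤ n ^ 4 * (n ^ 2 + n ^ 2) := by
        have : (n : ℝ) ≤ n ^ 2 := le_self_pow₀ (by linarith) (by norm_num)
        gcongr
        linarith
      have h4 : (n : ℝ) ≤ n ^ 6 := le_self_pow₀ (by linarith) (by norm_num)
      rw [e]
      nlinarith
    have h2 : ((n : ℝ) ^ 7)⁻¹ * (∫ M, topEig M ^ 2 ∂(gueMeasure k) + (2 * q ^ 3) ^ 2) ≤ 6 / n := by
      calc _ ≤ ((n : ℝ) ^ 7)⁻¹ * (6 * n ^ 6) := by gcongr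
        _ = 6 / n := by field_simp
    have h3 : (gueMeasure k).real {M | 13144 * L ^ 8 / q < |topEig M - 2 * q ^ 3|} /
        (2 * ((n : ℝ) ^ 7)⁻¹) ≤ 1 / n := by
      calc _ ≤ ((n : ℝ) ^ 104)⁻¹ / (2 * ((n : ℝ) ^ 7)⁻¹) := by gcongr
        _ = 1 / (2 * n ^ 97) := by field_simp
        _ ≤ 1 / n := by
          have : (n : ℝ) ≤ n ^ 97 := le_self_pow₀ (by linarith) (by norm_num)
          gcongr
          linarith
    have h5 : 13144 / (n : ℝ) = 13137 / n + 6 / n + 1 / n := by ring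
    have h6 : 0 ≤ 13137 / (n : ℝ) := by positivity
    linarith
  have hsub : {M : Matrix (Fin k) (Fin k) ℂ | 39432 * L ^ 8 / q <
      |topEig M - ∫ M', topEig M' ∂(gueMeasure k)|} ⊆
      {M | 13144 * L ^ 8 / q < |topEig M - 2 * q ^ 3|} := by
    intro M hM
    simp only [Set.mem_ofPred_eq] at hM ⊢
    have h1 := abs_sub_le (topEig M) (2 * q ^ 3) (∫ M', topEig M' ∂(gueMeasure k))
    rw [abs_sub_comm (2 * q ^ 3)] at h1
    have h2 : 39432 * L ^ 8 / q = 3 * (13144 * L ^ 8 / q) := by ring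
    linarith
  refine ((measureReal_mono hsub).trans htail).trans ?_
  gcongr
  · linarith
  · norm_num

end

/-- The top-left `k × k` minor of an `n × n` matrix. -/
def topLeft {n k : ℕ} (h : k ≤ n) (M : Matrix (Fin n) (Fin n) ℂ) : Matrix (Fin k) (Fin k) ℂ :=
  M.submatrix (Fin.castLE h) (Fin.castLE h)

lemma measurable_topLeft {n k : ℕ} (h : k ≤ n) : Measurable (topLeft h) :=
  measurable_matrix_iff fun i j => measurable_entry (Fin.castLE h i) (Fin.castLE h j)

lemma gueMeasure_map_topLeft {n k : ℕ} (h : k ≤ n) :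
    (gueMeasure n).map (topLeft h) = gueMeasure k := by
  set P : Matrix (Fin n) (Fin k) ℂ := (1 : Matrix (Fin n) (Fin n) ℂ).submatrix id (Fin.castLE h)
  have hP : ∀ M : Matrix (Fin n) (Fin n) ℂ, P.conjTranspose * M * P = topLeft h M := by
    intro M
    ext a b
    simp [P, topLeft, Matrix.mul_apply, Matrix.one_apply]
  have hP1 : P.conjTranspose * P = 1 := by
    have := hP 1
    rw [Matrix.mul_one] at this
    rw [this, topLeft, Matrix.submatrix_one _ (Fin.castLE_injective h)]
  rw [← gueMeasure_map_compression hP1]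
  congr 1
  exact funext fun M => (hP M).symm

lemma minorEig_one {n k : ℕ} (σ : ℝ) (M : Matrix (Fin n) (Fin n) ℂ) (hk : 1 ≤ k) (hkn : k ≤ n) :
    minorEig σ M k 1 = √(σ ^ 2 * n) * topEig (topLeft hkn M) := by
  rw [minorEig, dif_pos ⟨le_rfl, hk, hkn⟩, topEig, dif_pos (by omega)]
  rfl

lemma minorEig_self {n k : ℕ} (σ : ℝ) (M : Matrix (Fin n) (Fin n) ℂ) (hk : 1 ≤ k) (hkn : k ≤ n) :
    minorEig σ M k k = -√(σ ^ 2 * n) * topEig (-topLeft hkn M) := by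
  rw [minorEig, dif_pos ⟨hk, le_rfl, hkn⟩, neg_mul, ← mul_neg,
    ← eigsDesc_last (topLeft hkn M) (i := ⟨k - 1, by omega⟩) (by simp; omega)]
  rfl

lemma measureReal_lt_abs_sub_integral_le {α : Type*} [MeasurableSpace α] {ν : Measure α} {k : ℕ}
    {g : α → Matrix (Fin k) (Fin k) ℂ} (hg : Measurable g) (hlaw : ν.map g = gueMeasure k)
    {c B p : ℝ} (h : (gueMeasure k).real
      {M | B < |topEig M - ∫ M', topEig M' ∂(gueMeasure k)|} ≤ p)
    {f : α → ℝ} (hf : ∀ ω, f ω = c * topEig (g ω)) :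
    ν.real {ω | |c| * B < |f ω - ∫ ω', f ω' ∂ν|} ≤ p := by
  have hint : ∫ ω, f ω ∂ν = c * ∫ M', topEig M' ∂(gueMeasure k) := by
    rw [← hlaw, integral_map hg.aemeasurable (measurable_topEig k).aestronglyMeasurable,
      ← integral_const_mul]
    simp_rw [hf]
  have hms : MeasurableSet
      {M : Matrix (Fin k) (Fin k) ℂ | B < |topEig M - ∫ M', topEig M' ∂(gueMeasure k)|} := by
    have := measurable_topEig k
    exact measurableSet_lt measurable_const (by fun_prop)
  have : IsProbabilityMeasure (ν.map g) := by rw [hlaw]; infer_instance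
  have : IsProbabilityMeasure ν :=
    ⟨by rw [← Set.preimage_univ (f := g), ← Measure.map_apply hg MeasurableSet.univ, measure_univ]⟩
  refine le_trans ?_ h
  rw [← hlaw, map_measureReal_apply hg (by rw [hlaw]; exact hms)]
  refine measureReal_mono fun ω hω => ?_
  rw [Set.mem_ofPred_eq, hint, hf, ← mul_sub, abs_mul, ← hlaw] at hω
  exact lt_of_mul_lt_mul_left hω (abs_nonneg c)

lemma sum_Icc_rpow_inv_le (n : ℕ) :
    ∑ k ∈ Finset.Icc 1 n, ((k : ℝ) ^ ((1 : ℝ) / 6))⁻¹ ≤ 2 * (n : ℝ) ^ ((5 : ℝ) / 6) := by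
  induction n with
  | zero => simp
  | succ n ih =>
    rw [Finset.sum_Icc_succ_top (by omega)]
    have hn1 : (0 : ℝ) < ((n + 1 : ℕ) : ℝ) := by positivity
    have h0 : (0 : ℝ) < ((n + 1 : ℕ) : ℝ) ^ ((1 : ℝ) / 6) := by positivity
    have hgm := Real.geom_mean_le_arith_mean2_weighted (w₁ := 5 / 6) (w₂ := 1 / 6)
      (p₁ := n) (p₂ := ((n + 1 : ℕ) : ℝ)) (by norm_num) (by norm_num) (by positivity) hn1.le
      (by norm_num)
    have hsplit : ((n + 1 : ℕ) : ℝ) ^ ((5 : ℝ) / 6) * ((n + 1 : ℕ) : ℝ) ^ ((1 : ℝ) / 6) =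
        ((n + 1 : ℕ) : ℝ) := by
      rw [← Real.rpow_add hn1]; norm_num
    have hcast : ((n + 1 : ℕ) : ℝ) = n + 1 := by push_cast; ring
    have hkey : 2 * (n : ℝ) ^ ((5 : ℝ) / 6) + (((n + 1 : ℕ) : ℝ) ^ ((1 : ℝ) / 6))⁻¹ ≤
        2 * ((n + 1 : ℕ) : ℝ) ^ ((5 : ℝ) / 6) := by
      refine le_of_mul_le_mul_right ?_ h0
      rw [add_mul, inv_mul_cancel₀ h0.ne', mul_assoc, mul_assoc, hsplit]
      linarith
    linarith

/-- Simultaneous concentration of finitely many sums from concentration of each summand. -/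
lemma ofReal_le_measure_sum_le {α ι : Type*} [MeasurableSpace α] {ν : Measure α}
    [IsProbabilityMeasure ν] {s : Finset ι} {f g : ι → α → ℝ} {a b : ι → ℝ} {p D ε : ℝ}
    (hf : ∀ k ∈ s, ν.real {ω | a k < f k ω} ≤ p) (hg : ∀ k ∈ s, ν.real {ω | b k < g k ω} ≤ p)
    (hD : ∑ k ∈ s, (a k + b k) ≤ D) (hε : 2 * s.card * p ≤ ε) :
    ENNReal.ofReal (1 - ε) ≤ ν {ω | ∑ k ∈ s, (f k ω + g k ω) ≤ D} := by
  set bad : Set α := ⋃ k ∈ s, ({ω | a k < f k ω} ∪ {ω | b k < g k ω})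
  have hbad : ν.real bad ≤ ε := by
    refine (measureReal_biUnion_finset_le _ _).trans ?_
    calc _ ≤ ∑ k ∈ s, (p + p) := Finset.sum_le_sum fun k hk =>
          (measureReal_union_le _ _).trans (add_le_add (hf k hk) (hg k hk))
      _ = 2 * s.card * p := by simp; ring
      _ ≤ ε := hε
  have hcover : Set.univ ⊆ {ω | ∑ k ∈ s, (f k ω + g k ω) ≤ D} ∪ bad := by
    intro ω _
    by_cases hω : ω ∈ bad
    · exact Or.inr hω
    · left
      simp only [bad, Set.mem_iUnion, Set.mem_union, Set.mem_ofPred_eq, not_exists, not_or,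
        not_lt] at hω
      exact (Finset.sum_le_sum fun k hk => add_le_add (hω k hk).1 (hω k hk).2).trans hD
  have h1 : 1 ≤ ν.real {ω | ∑ k ∈ s, (f k ω + g k ω) ≤ D} + ν.real bad := by
    have := (measureReal_mono (μ := ν) hcover).trans (measureReal_union_le _ _)
    rwa [probReal_univ] at this
  rw [← ofReal_measureReal (μ := ν)]
  exact ENNReal.ofReal_le_ofReal (by linarith)

/-- Fix `σ_λ, σ_μ > 0` and let `X_n, Y_n` be independent with
`X_n/√(σ_λ² n)`, `Y_n/√(σ_μ² n)` GUE.  With `λ_{j,k}` (resp. `μ_{j,k}`) the `j`-th largest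
eigenvalue of the top-left `k × k` minor of `X_n` (resp. `Y_n`), there are constants
`C', A > 0` depending only on `σ_λ, σ_μ` such that for all `n ≥ 2`, with probability at least
`1 − n^{−100}`,
`∑_{k=1}^n ( |μ_{1,k} − E μ_{1,k}| + |λ_{k,k} − E λ_{k,k}| ) ≤ C' n^{4/3} (log n)^A`. -/
theorem minor_eigenvalue_concentration (sl sm : ℝ) (hsl : 0 < sl) (hsm : 0 < sm) :
    ∃ C' A : ℝ, 0 < C' ∧ 0 < A ∧ ∀ n : ℕ, 2 ≤ n →
      ENNReal.ofReal (1 - (n : ℝ) ^ (-(100 : ℝ))) ≤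
        ((gueMeasure n).prod (gueMeasure n))
          {M | ∑ k ∈ Finset.Icc 1 n,
              (|minorEig sm M.2 k 1 -
                  ∫ M', minorEig sm M'.2 k 1 ∂((gueMeasure n).prod (gueMeasure n))| +
               |minorEig sl M.1 k k -
                  ∫ M', minorEig sl M'.1 k k ∂((gueMeasure n).prod (gueMeasure n))|)
            ≤ C' * (n : ℝ) ^ ((4 : ℝ) / 3) * Real.log n ^ A} := by
  refine ⟨2 * (sm + sl) * (39432 * 110 ^ 8), 8, by positivity, by norm_num, fun n hn => ?_⟩
  have hn' : (2 : ℝ) ≤ n := by exact_mod_cast hn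
  have hn0 : (0 : ℝ) < n := by linarith
  set B : ℕ → ℝ := fun k => 39432 * (110 * Real.log n) ^ 8 / (k : ℝ) ^ ((1 : ℝ) / 6) with hB
  have hsqrt : ∀ σ : ℝ, 0 < σ → √(σ ^ 2 * n) = σ * √n := fun σ hσ => by
    rw [Real.sqrt_mul (sq_nonneg σ), Real.sqrt_sq hσ.le]
  have hconc : ∀ k ∈ Finset.Icc 1 n, (gueMeasure k).real
      {M | B k < |topEig M - ∫ M', topEig M' ∂(gueMeasure k)|} ≤ ((n : ℝ) ^ 102)⁻¹ := by
    intro k hk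
    rw [Finset.mem_Icc] at hk
    have hk1 : (1 : ℝ) ≤ k := by exact_mod_cast hk.1
    refine gueMeasure_topEig_sub_integral_le hn hk.1 hk.2 (Real.one_le_rpow hk1 (by norm_num)) ?_
    rw [← Real.rpow_natCast, ← Real.rpow_mul (by linarith)]
    norm_num
  refine ofReal_le_measure_sum_le (p := ((n : ℝ) ^ 102)⁻¹)
    (a := fun k => |√(sm ^ 2 * n)| * B k) (b := fun k => |-√(sl ^ 2 * n)| * B k) ?_ ?_ ?_ ?_
  · intro k hk
    have hk' := Finset.mem_Icc.1 hk
    refine measureReal_lt_abs_sub_integral_le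
      (g := fun M : Matrix (Fin n) (Fin n) ℂ × Matrix (Fin n) (Fin n) ℂ => topLeft hk'.2 M.2)
      ((measurable_topLeft hk'.2).comp measurable_snd) ?_ (hconc k hk)
      fun M => minorEig_one sm M.2 hk'.1 hk'.2
    change Measure.map (topLeft hk'.2 ∘ Prod.snd) _ = _
    rw [← Measure.map_map (measurable_topLeft hk'.2) measurable_snd,
      show Measure.map Prod.snd ((gueMeasure n).prod (gueMeasure n)) = gueMeasure n from
        Measure.snd_prod, gueMeasure_map_topLeft]
  · intro k hk
    have hk' := Finset.mem_Icc.1 hk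
    refine measureReal_lt_abs_sub_integral_le
      (g := fun M : Matrix (Fin n) (Fin n) ℂ × Matrix (Fin n) (Fin n) ℂ => -topLeft hk'.2 M.1)
      (measurable_matrix_neg.comp ((measurable_topLeft hk'.2).comp measurable_fst)) ?_ (hconc k hk)
      fun M => minorEig_self sl M.1 hk'.1 hk'.2
    change Measure.map ((fun M => -M) ∘ topLeft hk'.2 ∘ Prod.fst) _ = _
    rw [← Measure.map_map measurable_matrix_neg ((measurable_topLeft hk'.2).comp measurable_fst),
      ← Measure.map_map (measurable_topLeft hk'.2) measurable_fst,
      show Measure.map Prod.fst ((gueMeasure n).prod (gueMeasure n)) = gueMeasure n from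
        Measure.fst_prod, gueMeasure_map_topLeft, gueMeasure_map_neg]
  · have hpow : √(n : ℝ) * (n : ℝ) ^ ((5 : ℝ) / 6) = (n : ℝ) ^ ((4 : ℝ) / 3) := by
      rw [Real.sqrt_eq_rpow, ← Real.rpow_add hn0]; norm_num
    have hlog : Real.log n ^ (8 : ℝ) = Real.log n ^ 8 := by
      rw [← Real.rpow_natCast]; norm_num
    have hsum : ∑ k ∈ Finset.Icc 1 n, (|√(sm ^ 2 * n)| * B k + |-√(sl ^ 2 * n)| * B k) =
        (sm + sl) * √n * (39432 * 110 ^ 8 * Real.log n ^ 8) *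
          ∑ k ∈ Finset.Icc 1 n, ((k : ℝ) ^ ((1 : ℝ) / 6))⁻¹ := by
      rw [Finset.mul_sum]
      refine Finset.sum_congr rfl fun k _ => ?_
      rw [abs_neg, abs_of_nonneg (Real.sqrt_nonneg _), abs_of_nonneg (Real.sqrt_nonneg _),
        hsqrt sm hsm, hsqrt sl hsl, hB]
      ring
    rw [hsum, hlog, ← hpow]
    have hl : 0 ≤ Real.log n := Real.log_nonneg (by linarith)
    calc _ ≤ (sm + sl) * √n * (39432 * 110 ^ 8 * Real.log n ^ 8) *
          (2 * (n : ℝ) ^ ((5 : ℝ) / 6)) := by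
          gcongr
          exact sum_Icc_rpow_inv_le n
      _ = _ := by ring
  · rw [Real.rpow_neg hn0.le, show (100 : ℝ) = (100 : ℕ) by norm_num, Real.rpow_natCast,
      Nat.card_Icc, Nat.add_sub_cancel]
    calc 2 * (n : ℝ) * ((n : ℝ) ^ 102)⁻¹ ≤ n * n * ((n : ℝ) ^ 102)⁻¹ := by gcongr
      _ = ((n : ℝ) ^ 100)⁻¹ := by field_simp
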